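/- Let R be a Noetherian ring and I an ideal of R such that mAss_R R = 𝔄(I,R) ∪ 𝔅(I,R) ∪ 𝔇(I,R). Then I ∈ 𝓘(R); that is, for every finitely generated R-module M, the local cohomology modules H^i_I(M) are I-cofinite for all i ≥ 0. -/

import Mathlib

universe u

open CategoryTheory

/-- An `R`-module `L` is `I`-cofinite if `Supp L ⊆ V(I)` and `Ext^i_R(R/I, L)` is a finitely
generated `R`-module for all `i ≥ 0`. -/
def IsCofinite {R : Type u} [CommRing R] (I : Ideal R) (L : ModuleCat.{u} R) : Prop :=
  Module.support R L ⊆ PrimeSpectrum.zeroLocus (I : Set R) ∧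
    ∀ i : ℕ, Module.Finite R
      (((Ext R (ModuleCat.{u} R) i).obj (Opposite.op (ModuleCat.of R (R ⧸ I)))).obj L)

/-- The cohomological dimension `cd(I, M)`: the supremum (in `WithBot ℕ∞`, so that the
supremum of the empty set is `⊥ = -∞`) of the set of indices `i` with `H^i_I(M) ≠ 0`. -/
noncomputable def cohomologicalDim {R : Type u} [CommRing R] (I : Ideal R)
    (M : ModuleCat.{u} R) : WithBot ℕ∞ :=
  sSup ((fun i : ℕ => ((i : ℕ∞) : WithBot ℕ∞)) ''
    {i : ℕ | Nontrivial ((localCohomology I i).obj M)})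

/-- `mAss_R R`: the set of minimal elements of `Ass_R R` with respect to inclusion. -/
def minimalAssociatedPrimes (R : Type u) [CommRing R] : Set (Ideal R) :=
  {p ∈ associatedPrimes R R | ∀ q ∈ associatedPrimes R R, q ≤ p → q = p}

/-- `𝔄(I,R) = { p ∈ mAss_R R : I + p = R or p ⊇ I }`. -/
def frakA {R : Type u} [CommRing R] (I : Ideal R) : Set (Ideal R) :=
  {p ∈ minimalAssociatedPrimes R | I + p = ⊤ ∨ I ≤ p}

/-- `𝔅(I,R) = { p ∈ mAss_R R : cd(I, R/p) = 1 }`. -/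
noncomputable def frakB {R : Type u} [CommRing R] (I : Ideal R) : Set (Ideal R) :=
  {p ∈ minimalAssociatedPrimes R | cohomologicalDim I (ModuleCat.of R (R ⧸ p)) = 1}

/-- `𝔇(I,R) = { p ∈ mAss_R R : 0 ≤ dim R/(I + p) ≤ 1 }`. -/
def frakD {R : Type u} [CommRing R] (I : Ideal R) : Set (Ideal R) :=
  {p ∈ minimalAssociatedPrimes R |
    0 ≤ ringKrullDim (R ⧸ (I + p)) ∧ ringKrullDim (R ⧸ (I + p)) ≤ 1}



namespace CofPf

section Bridge

open Opposite HomologicalComplex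

variable {R : Type u} [CommRing R]

/-- The functor `Hom(-,Y)` used in the definition of the (old) `Ext`. -/
noncomputable abbrev yF (Y : ModuleCat.{u} R) : ModuleCat.{u} R ⥤ (ModuleCat.{u} R)ᵒᵖ :=
  ((linearYoneda R (ModuleCat.{u} R)).obj Y).rightOp

/-- complex -/
noncomputable abbrev yK {X : ModuleCat.{u} R} (P : ProjectiveResolution X) (Y : ModuleCat.{u} R) :
    ChainComplex (ModuleCat.{u} R)ᵒᵖ ℕ :=
  ((yF Y).mapHomologicalComplex (ComplexShape.down ℕ)).obj P.complex

/-- the module of cocycles -/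
noncomputable abbrev yZ {X : ModuleCat.{u} R} (P : ProjectiveResolution X) (Y : ModuleCat.{u} R)
    (n : ℕ) : ModuleCat.{u} R := ((yK P Y).opcycles n).unop

/-- inclusion of cocycles -/
noncomputable def yι {X : ModuleCat.{u} R} (P : ProjectiveResolution X) (Y : ModuleCat.{u} R)
    (n : ℕ) : yZ P Y n →ₗ[R] (P.complex.X n ⟶ Y) := ((yK P Y).pOpcycles n).unop.hom

/-- the comparison isomorphism -/
noncomputable def yiso {X : ModuleCat.{u} R} (P : ProjectiveResolution X) (Y : ModuleCat.{u} R)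
    (n : ℕ) : ((yF Y).leftDerived n).obj X ≅ (yK P Y).homology n := P.isoLeftDerivedObj (yF Y) n

/-- projection to the old Ext. -/
noncomputable def yπ {X : ModuleCat.{u} R} (P : ProjectiveResolution X) (Y : ModuleCat.{u} R)
    (n : ℕ) : yZ P Y n →ₗ[R] (((_root_.Ext R (ModuleCat.{u} R) n).obj (op X)).obj Y) :=
  ((yiso P Y n).hom ≫ (yK P Y).homologyι n).unop.hom

lemma yι_cocycle {X : ModuleCat.{u} R} (P : ProjectiveResolution X) (Y : ModuleCat.{u} R)
    (n : ℕ) (a : yZ P Y n) : P.complex.d (n+1) n ≫ yι P Y n a = 0 := by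
  have h := (yK P Y).d_pOpcycles (n+1) n
  have h2 := congrArg Quiver.Hom.unop h
  have h3 := LinearMap.congr_fun (congrArg ModuleCat.Hom.hom h2) a
  exact h3

lemma yι_surj {X : ModuleCat.{u} R} (P : ProjectiveResolution X) (Y : ModuleCat.{u} R)
    (n : ℕ) (f : P.complex.X n ⟶ Y) (hf : P.complex.d (n+1) n ≫ f = 0) :
    ∃ a, yι P Y n a = f := by
  let φ : ModuleCat.of R R ⟶ ((yK P Y).X n).unop :=
    ModuleCat.ofHom (LinearMap.toSpanSingleton R (P.complex.X n ⟶ Y) f)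
  have hφ : (yK P Y).d (n+1) n ≫ φ.op = 0 := by
    apply Quiver.Hom.unop_inj
    ext
    change P.complex.d (n+1) n ≫ ((1:R) • f) = 0
    rw [one_smul, hf]
  let ψ := (yK P Y).descOpcycles φ.op (n+1) (by simp) hφ
  have h : (yK P Y).pOpcycles n ≫ ψ = φ.op := (yK P Y).p_descOpcycles _ _ _ _
  have h2 := LinearMap.congr_fun (congrArg ModuleCat.Hom.hom (congrArg Quiver.Hom.unop h)) (1:R)
  refine ⟨ψ.unop.hom (1:R), h2.trans ?_⟩
  change (1:R) • f = f
  rw [one_smul]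

lemma yπ_surj {X : ModuleCat.{u} R} (P : ProjectiveResolution X) (Y : ModuleCat.{u} R)
    (n : ℕ) : Function.Surjective (yπ P Y n) := by
  have : Mono ((yiso P Y n).hom ≫ (yK P Y).homologyι n) := mono_comp _ _
  have : Epi ((yiso P Y n).hom ≫ (yK P Y).homologyι n).unop := inferInstance
  exact (ModuleCat.epi_iff_surjective _).1 this

lemma yι_inj {X : ModuleCat.{u} R} (P : ProjectiveResolution X) (Y : ModuleCat.{u} R)
    (n : ℕ) : Function.Injective (yι P Y n) := by
  have : Mono ((yK P Y).pOpcycles n).unop := inferInstance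
  exact (ModuleCat.mono_iff_injective _).1 this

lemma yπ_eq_zero_iff {X : ModuleCat.{u} R} (P : ProjectiveResolution X) (Y : ModuleCat.{u} R)
    (n : ℕ) (a : yZ P Y n) : yπ P Y n a = 0 ↔
      ∃ g : P.complex.X ((ComplexShape.down ℕ).next n) ⟶ Y,
        P.complex.d n ((ComplexShape.down ℕ).next n) ≫ g = yι P Y n a := by
  set j := (ComplexShape.down ℕ).next n with hj
  have hker := (yK P Y).homologyIsKernel n j rfl
  let S : ShortComplex (ModuleCat.{u} R)ᵒᵖ :=
    ShortComplex.mk ((yK P Y).homologyι n) ((yK P Y).fromOpcycles n j) (by simp)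
  have hS : S.Exact := ShortComplex.exact_of_f_is_kernel S hker
  have hS' := hS.unop
  have hex := (ShortComplex.ShortExact.moduleCat_exact_iff_function_exact _).1 hS' a
  have h0 : yπ P Y n a = 0 ↔ ((yK P Y).homologyι n).unop.hom a = 0 := by
    constructor
    · intro h
      have h1 : ((yK P Y).homologyι n).unop = ((yiso P Y n).hom ≫ (yK P Y).homologyι n).unop
          ≫ (yiso P Y n).inv.unop := by
        rw [← unop_comp]; simp
      rw [h1, ModuleCat.hom_comp, LinearMap.comp_apply]
      exact (congrArg ((yiso P Y n).inv.unop.hom) h).trans (map_zero ((yiso P Y n).inv.unop.hom))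
    · intro h
      change (((yiso P Y n).hom ≫ (yK P Y).homologyι n).unop.hom) a = 0
      rw [unop_comp, ModuleCat.hom_comp, LinearMap.comp_apply, h, map_zero]
  have h1 : ∀ g : ((yK P Y).X j).unop, yι P Y n (((yK P Y).fromOpcycles n j).unop.hom g)
      = P.complex.d n j ≫ (show P.complex.X j ⟶ Y from g) := by
    intro g
    have := (yK P Y).p_fromOpcycles n j
    exact LinearMap.congr_fun (congrArg ModuleCat.Hom.hom (congrArg Quiver.Hom.unop this)) g
  rw [h0]
  refine hex.trans ?_
  constructor
  · rintro ⟨g, hg⟩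
    exact ⟨g, (h1 g).symm.trans (congrArg (yι P Y n) hg)⟩
  · rintro ⟨g, hg⟩
    exact ⟨g, yι_inj P Y n ((h1 g).trans hg)⟩

/-- projection to the new Ext -/
noncomputable def yθ {X : ModuleCat.{u} R} (P : ProjectiveResolution X) (Y : ModuleCat.{u} R)
    (n : ℕ) : yZ P Y n →ₗ[R] Abelian.Ext X Y n where
  toFun a := P.extMk (yι P Y n a) (n+1) rfl (yι_cocycle P Y n a)
  map_add' a b := by
    rw [P.add_extMk]
    congr 1
    simp
  map_smul' r a := by
    have h := P.extMk_comp_mk₀ (yι P Y n a) (n+1) rfl (yι_cocycle P Y n a) (r • 𝟙 Y)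
    rw [RingHom.id_apply]
    have h2 : P.extMk (yι P Y n (r • a)) (n+1) rfl (yι_cocycle P Y n _) =
      P.extMk (yι P Y n a ≫ (r • 𝟙 Y)) (n+1) rfl (by
        rw [← Category.assoc, yι_cocycle, Limits.zero_comp]) := by
      congr 1
      simp
    rw [h2, ← h]
    simp [Abelian.Ext.mk₀_smul]

lemma yθ_surj {X : ModuleCat.{u} R} (P : ProjectiveResolution X) (Y : ModuleCat.{u} R)
    (n : ℕ) : Function.Surjective (yθ P Y n) := by
  intro α
  obtain ⟨f, hf, rfl⟩ := P.extMk_surjective α (n+1) rfl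
  obtain ⟨a, rfl⟩ := yι_surj P Y n f hf
  exact ⟨a, rfl⟩

lemma yθ_eq_zero_iff {X : ModuleCat.{u} R} (P : ProjectiveResolution X) (Y : ModuleCat.{u} R)
    (n : ℕ) (a : yZ P Y n) : yθ P Y n a = 0 ↔
      ∃ g : P.complex.X ((ComplexShape.down ℕ).next n) ⟶ Y,
        P.complex.d n ((ComplexShape.down ℕ).next n) ≫ g = yι P Y n a := by
  change P.extMk (yι P Y n a) (n+1) rfl (yι_cocycle P Y n a) = 0 ↔ _
  cases n with
  | succ p =>
    rw [P.extMk_eq_zero_iff _ _ _ _ p rfl]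
    have : (ComplexShape.down ℕ).next (p+1) = p := by simp
    rw [this]
  | zero =>
    constructor
    · intro h
      rw [← P.extEquivCohomologyClass.apply_eq_iff_eq,
        ProjectiveResolution.extEquivCohomologyClass_extMk,
        ProjectiveResolution.extEquivCohomologyClass_zero,
        CochainComplex.HomComplex.CohomologyClass.mk_eq_zero_iff,
        CochainComplex.HomComplex.Cocycle.toSingleMk_mem_coboundaries_iff _ _ _ _ _ 1 (by simp)] at h
      obtain ⟨g, hg⟩ := h
      have hz : P.cochainComplex.d (-((0:ℕ):ℤ)) 1 = 0 := by
        apply Limits.IsZero.eq_of_tgt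
        exact P.cochainComplex.isZero_of_isStrictlyLE 0 1 (by simp)
      rw [hz, Limits.zero_comp] at hg
      refine ⟨0, ?_⟩
      rw [Limits.comp_zero]
      symm
      have := congrArg (fun t => (P.cochainComplexXIso (-((0:ℕ):ℤ)) 0 rfl).inv ≫ t) hg
      simpa using this.symm
    · rintro ⟨g, hg⟩
      have : P.complex.d 0 ((ComplexShape.down ℕ).next 0) = 0 := by
        apply P.complex.shape
        simp
      rw [this, Limits.zero_comp] at hg
      simp [← hg]

lemma yker {X : ModuleCat.{u} R} (P : ProjectiveResolution X) (Y : ModuleCat.{u} R)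
    (n : ℕ) : LinearMap.ker (yπ P Y n) = LinearMap.ker (yθ P Y n) := by
  ext a
  simp [yπ_eq_zero_iff, yθ_eq_zero_iff]

/-- comparison of the two `Ext`s -/
noncomputable def extEq (X Y : ModuleCat.{u} R) (n : ℕ) :
    (((_root_.Ext R (ModuleCat.{u} R) n).obj (op X)).obj Y) ≃ₗ[R] Abelian.Ext X Y n :=
  ((yπ (projectiveResolution X) Y n).quotKerEquivOfSurjective (yπ_surj _ Y n)).symm ≪≫ₗ
    Submodule.quotEquivOfEq _ _ (yker _ Y n) ≪≫ₗ
    ((yθ (projectiveResolution X) Y n).quotKerEquivOfSurjective (yθ_surj _ Y n))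

lemma extEq_yπ (X Y : ModuleCat.{u} R) (n : ℕ) (a) :
    extEq X Y n (yπ (projectiveResolution X) Y n a) = yθ (projectiveResolution X) Y n a := by
  have : ((yπ (projectiveResolution X) Y n).quotKerEquivOfSurjective (yπ_surj _ Y n)).symm
    (yπ (projectiveResolution X) Y n a) = Submodule.Quotient.mk a := by
    rw [LinearEquiv.symm_apply_eq]
    rfl
  simp only [extEq, LinearEquiv.trans_apply, this]
  rfl

lemma lift0 {X X' : ModuleCat.{u} R} (g : X' ⟶ X) (P' : ProjectiveResolution X')
    (P : ProjectiveResolution X) :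
    (ProjectiveResolution.lift g P' P).f 0 ≫ P.π.f 0 = P'.π.f 0 ≫ g := by
  have h1 := ProjectiveResolution.lift_commutes g P' P
  exact congrArg (fun t => HomologicalComplex.Hom.f t 0) h1

lemma extEq_naturality {X X' : ModuleCat.{u} R} (g : X' ⟶ X) (Y : ModuleCat.{u} R) (n : ℕ)
    (e : (((_root_.Ext R (ModuleCat.{u} R) n).obj (op X)).obj Y)) :
    extEq X' Y n ((((_root_.Ext R (ModuleCat.{u} R) n).map g.op).app Y).hom e) =
      (Abelian.Ext.mk₀ g).comp (extEq X Y n e) (zero_add n) := by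
  obtain ⟨a, rfl⟩ := yπ_surj (projectiveResolution X) Y n e
  let P := projectiveResolution X
  let P' := projectiveResolution X'
  let φ : P'.Hom P g := ⟨ProjectiveResolution.lift g P' P, lift0 g P' P⟩
  let φY : yK P' Y ⟶ yK P Y := ((yF Y).mapHomologicalComplex (ComplexShape.down ℕ)).map φ.hom
  have key : (((_root_.Ext R (ModuleCat.{u} R) n).map g.op).app Y).hom (yπ P Y n a) =
      yπ P' Y n ((opcyclesMap φY n).unop.hom a) := by
    have h1 := ProjectiveResolution.isoLeftDerivedObj_hom_naturality g P' P φ.hom (lift0 g P' P) (yF Y) n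
    have h2 := homologyι_naturality φY n
    have h3 : ((yF Y).leftDerived n).map g ≫ ((yiso P Y n).hom ≫ (yK P Y).homologyι n)
      = ((yiso P' Y n).hom ≫ (yK P' Y).homologyι n) ≫ opcyclesMap φY n := by
      have h1' : ((yF Y).leftDerived n).map g ≫ (yiso P Y n).hom =
        (yiso P' Y n).hom ≫ homologyMap φY n := h1
      rw [← Category.assoc, h1', Category.assoc, Category.assoc, h2]
    exact LinearMap.congr_fun (congrArg ModuleCat.Hom.hom (congrArg Quiver.Hom.unop h3)) a
  have key2 : yι P' Y n ((opcyclesMap φY n).unop.hom a) = φ.hom.f n ≫ yι P Y n a := by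
    have := p_opcyclesMap φY n
    exact LinearMap.congr_fun (congrArg ModuleCat.Hom.hom (congrArg Quiver.Hom.unop this)) a
  rw [key, extEq_yπ, extEq_yπ]
  refine Eq.trans ?_ (ProjectiveResolution.mk₀_comp_extMk (yι P Y n a) (n+1) rfl
    (yι_cocycle P Y n a) φ).symm
  change P'.extMk (yι P' Y n _) (n+1) rfl (yι_cocycle P' Y n _) = _
  congr 1

end Bridge

end CofPf

namespace CofPf

section LC

open Opposite Limits

variable {R : Type u} [CommRing R]

/-- `R/I^n` as an object. -/
noncomputable abbrev qX (I : Ideal R) (n : ℕ) : ModuleCat.{u} R := ModuleCat.of R (R ⧸ I ^ n)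

/-- transition maps -/
noncomputable def qT (I : Ideal R) {n m : ℕ} (h : n ≤ m) : qX I m ⟶ qX I n :=
  ModuleCat.ofHom (Submodule.mapQ (I ^ m) (I ^ n) LinearMap.id (Ideal.pow_le_pow_right h))

lemma qT_refl (I : Ideal R) (n : ℕ) : qT I (le_refl n) = 𝟙 _ := by
  ext
  rfl

lemma qT_comp (I : Ideal R) {n m k : ℕ} (h : n ≤ m) (h' : m ≤ k) :
    qT I h' ≫ qT I h = qT I (h.trans h') := by
  ext
  rfl

/-- transition maps on Ext -/
noncomputable def eT (I : Ideal R) (i : ℕ) (M : ModuleCat.{u} R) (n m : ℕ) (h : n ≤ m) :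
    Abelian.Ext (qX I n) M i →ₗ[R] Abelian.Ext (qX I m) M i :=
  (Abelian.Ext.bilinearCompOfLinear R (qX I m) (qX I n) M 0 i i (zero_add i))
    (Abelian.Ext.mk₀ (qT I h))

lemma eT_apply (I : Ideal R) (i : ℕ) (M : ModuleCat.{u} R) (n m : ℕ) (h : n ≤ m)
   (e : Abelian.Ext (qX I n) M i) :
   eT I i M n m h e = (Abelian.Ext.mk₀ (qT I h)).comp e (zero_add i) := rfl

instance (I : Ideal R) (i : ℕ) (M : ModuleCat.{u} R) :
    DirectedSystem (fun n => Abelian.Ext (qX I n) M i) (fun n m h => eT I i M n m h) where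
  map_self n x := by
    rw [eT_apply, qT_refl, Abelian.Ext.mk₀_id_comp]
  map_map n m k h h' x := by
    rw [eT_apply, eT_apply, eT_apply, ← qT_comp I h h', Abelian.Ext.mk₀_comp_mk₀_assoc]

/-- local cohomology as a direct limit of new Ext's. -/
abbrev DL (I : Ideal R) (i : ℕ) (M : ModuleCat.{u} R) : Type u :=
  Module.DirectLimit (fun n => Abelian.Ext (qX I n) M i) (fun n m h => eT I i M n m h)

/-- evaluate colimit -/
noncomputable def lcCocone (I : Ideal R) (i : ℕ) (M : ModuleCat.{u} R) :
    Cocone (localCohomology.diagram (localCohomology.idealPowersDiagram I) i ⋙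
      (evaluation (ModuleCat.{u} R) (ModuleCat.{u} R)).obj M) :=
  have := localCohomology.hasColimitDiagram.{u, 0} (localCohomology.idealPowersDiagram I) i
  ((evaluation (ModuleCat.{u} R) (ModuleCat.{u} R)).obj M).mapCocone
    (colimit.cocone (localCohomology.diagram (localCohomology.idealPowersDiagram I) i))

noncomputable def lcIsColimit (I : Ideal R) (i : ℕ) (M : ModuleCat.{u} R) :
    IsColimit (lcCocone I i M) :=
  have := localCohomology.hasColimitDiagram.{u, 0} (localCohomology.idealPowersDiagram I) i
  isColimitOfPreserves _ (colimit.isColimit _)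

/-- structure maps -/
noncomputable def lcψ (I : Ideal R) (i : ℕ) (M : ModuleCat.{u} R) (n : ℕ) :
    Abelian.Ext (qX I n) M i →ₗ[R] ((localCohomology I i).obj M) :=
  ((lcCocone I i M).ι.app (op (op n))).hom ∘ₗ (extEq (qX I n) M i).symm.toLinearMap

lemma lcψ_eT (I : Ideal R) (i : ℕ) (M : ModuleCat.{u} R) (n m : ℕ) (h : n ≤ m)
    (e : Abelian.Ext (qX I n) M i) : lcψ I i M m (eT I i M n m h e) = lcψ I i M n e := by
  obtain ⟨e, rfl⟩ := (extEq (qX I n) M i).surjective e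
  have hw := (lcCocone I i M).w (j' := op (op n)) (j := op (op m)) (homOfLE h).op.op
  have hn := extEq_naturality (qT I h) M i e
  have h2 : (extEq (qX I m) M i).symm (eT I i M n m h (extEq (qX I n) M i e)) =
    (((_root_.Ext R (ModuleCat.{u} R) i).map (qT I h).op).app M).hom e := by
    rw [LinearEquiv.symm_apply_eq, hn]
    rfl
  change ((lcCocone I i M).ι.app (op (op m))).hom ((extEq (qX I m) M i).symm _) =
    ((lcCocone I i M).ι.app (op (op n))).hom ((extEq (qX I n) M i).symm _)
  rw [h2, LinearEquiv.symm_apply_apply]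
  exact LinearMap.congr_fun (congrArg ModuleCat.Hom.hom hw) e

instance : PreservesColimitsOfShape ℕᵒᵖᵒᵖ (forget (ModuleCat.{u} R)) := by
  have := preservesSmallestFilteredColimits_of_preservesFilteredColimits.{u, u} (forget (ModuleCat.{u} R))
  have := IsFiltered.of_equivalence (opOpEquivalence ℕ).symm
  infer_instance

instance : IsFiltered ℕᵒᵖᵒᵖ := IsFiltered.of_equivalence (opOpEquivalence ℕ).symm

lemma lcψ_apply (I : Ideal R) (i : ℕ) (M : ModuleCat.{u} R) (n : ℕ) (e) :
    lcψ I i M n (extEq (qX I n) M i e) = ((lcCocone I i M).ι.app (op (op n))).hom e := by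
  change ((lcCocone I i M).ι.app (op (op n))).hom ((extEq (qX I n) M i).symm _) = _
  rw [LinearEquiv.symm_apply_apply]

lemma lcψ_surj (I : Ideal R) (i : ℕ) (M : ModuleCat.{u} R) (x : (localCohomology I i).obj M) :
    ∃ n e, lcψ I i M n e = x := by
  obtain ⟨⟨⟨n⟩⟩, y, hy⟩ := Concrete.isColimit_exists_rep _ (lcIsColimit I i M) x
  exact ⟨n, extEq _ M i y, (lcψ_apply I i M n y).trans hy⟩

lemma lcψ_inj (I : Ideal R) (i : ℕ) (M : ModuleCat.{u} R) (n : ℕ) (e : Abelian.Ext (qX I n) M i)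
    (h : lcψ I i M n e = 0) : ∃ m, ∃ h : n ≤ m, eT I i M n m h e = 0 := by
  obtain ⟨e, rfl⟩ := (extEq (qX I n) M i).surjective e
  have h' : (lcCocone I i M).ι.app (op (op n)) e = (lcCocone I i M).ι.app (op (op n)) 0 := by
    rw [map_zero]
    exact (lcψ_apply I i M n e).symm.trans h
  obtain ⟨⟨⟨m⟩⟩, f, g, hfg⟩ := Concrete.isColimit_exists_of_rep_eq _ (lcIsColimit I i M) _ _ h'
  rw [map_zero] at hfg
  have hle : n ≤ m := f.unop.unop.le
  refine ⟨m, hle, ?_⟩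
  have hn := extEq_naturality (qT I hle) M i e
  change (Abelian.Ext.mk₀ (qT I hle)).comp (extEq (qX I n) M i e) (zero_add i) = 0
  rw [← hn]
  refine (congrArg (extEq (qX I m) M i) ?_).trans (map_zero _)
  exact hfg

/-- local cohomology is the direct limit of the new Ext's. -/
noncomputable def lcEquiv (I : Ideal R) (i : ℕ) (M : ModuleCat.{u} R) :
    DL I i M ≃ₗ[R] (localCohomology I i).obj M :=
  LinearEquiv.ofBijective
    (Module.DirectLimit.lift R ℕ _ _ (fun n => lcψ I i M n) (fun n m h e => lcψ_eT I i M n m h e)) (by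
    constructor
    · rw [injective_iff_map_eq_zero]
      intro x hx
      obtain ⟨n, e, rfl⟩ := Module.DirectLimit.exists_of x
      rw [Module.DirectLimit.lift_of] at hx
      obtain ⟨m, h, h0⟩ := lcψ_inj I i M n e hx
      rw [← Module.DirectLimit.of_f (hij := h), h0, map_zero]
    · intro x
      obtain ⟨n, e, rfl⟩ := lcψ_surj I i M x
      exact ⟨Module.DirectLimit.of R ℕ _ _ n e, Module.DirectLimit.lift_of ..⟩)

end LC

end CofPf

namespace CofPf

section Toolkit

open Abelian

variable (R : Type u) [CommRing R]

/-- unbundled `Ext` -/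
abbrev EE (A K : Type u) [AddCommGroup A] [Module R A] [AddCommGroup K] [Module R K] (i : ℕ) :
    Type u := Abelian.Ext (ModuleCat.of R A) (ModuleCat.of R K) i

variable {R}

variable {A A' K L N : Type u} [AddCommGroup A] [Module R A] [AddCommGroup A'] [Module R A']
  [AddCommGroup K] [Module R K] [AddCommGroup L] [Module R L] [AddCommGroup N] [Module R N]

variable (A) in
/-- covariant functoriality -/
noncomputable def epost (f : K →ₗ[R] L) (i : ℕ) : EE R A K i →ₗ[R] EE R A L i :=
  (Ext.bilinearCompOfLinear R (ModuleCat.of R A) (ModuleCat.of R K) (ModuleCat.of R L) i 0 i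
    (add_zero i)).flip (Ext.mk₀ (ModuleCat.ofHom f))

lemma epost_apply (f : K →ₗ[R] L) (i : ℕ) (e : EE R A K i) :
    epost A f i e = Ext.comp e (Ext.mk₀ (ModuleCat.ofHom f)) (add_zero i) := rfl

variable (K) in
/-- contravariant functoriality -/
noncomputable def epre (t : A' →ₗ[R] A) (i : ℕ) : EE R A K i →ₗ[R] EE R A' K i :=
  (Ext.bilinearCompOfLinear R (ModuleCat.of R A') (ModuleCat.of R A) (ModuleCat.of R K) 0 i i
    (zero_add i)) (Ext.mk₀ (ModuleCat.ofHom t))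

lemma epre_apply (t : A' →ₗ[R] A) (i : ℕ) (e : EE R A K i) :
    epre K t i e = (Ext.mk₀ (ModuleCat.ofHom t)).comp e (zero_add i) := rfl

lemma epost_id (i : ℕ) (e : EE R A K i) : epost A (LinearMap.id : K →ₗ[R] K) i e = e := by
  rw [epost_apply]
  exact Ext.comp_mk₀_id e

lemma epost_comp (f : K →ₗ[R] L) (g : L →ₗ[R] N) (i : ℕ) (e : EE R A K i) :
    epost A (g ∘ₗ f) i e = epost A g i (epost A f i e) := by
  simp only [epost_apply, ModuleCat.ofHom_comp]
  rw [← Ext.mk₀_comp_mk₀, ← Ext.comp_assoc_of_third_deg_zero]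

lemma epost_add (f g : K →ₗ[R] L) (i : ℕ) : epost A (f + g) i = epost A f i + epost A g i := by
  ext e
  simp only [epost_apply, LinearMap.add_apply]
  rw [← Ext.comp_add, ← Ext.mk₀_add]
  rfl

lemma epost_smul (r : R) (f : K →ₗ[R] L) (i : ℕ) : epost A (r • f) i = r • epost A f i := by
  ext e
  simp only [epost_apply, LinearMap.smul_apply]
  rw [← Ext.comp_smul, ← Ext.mk₀_smul]
  rfl

lemma epost_zero (i : ℕ) : epost A (0 : K →ₗ[R] L) i = 0 := by
  have := epost_smul (A := A) (0 : R) (0 : K →ₗ[R] L) i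
  simpa using this

lemma epost_sum {ι : Type*} (s : Finset ι) (f : ι → (K →ₗ[R] L)) (i : ℕ) :
    epost A (∑ j ∈ s, f j) i = ∑ j ∈ s, epost A (f j) i := by
  classical
  induction s using Finset.induction_on with
  | empty => simp [epost_zero]
  | insert a s ha ih => rw [Finset.sum_insert ha, Finset.sum_insert ha, epost_add, ih]

lemma epre_epost (t : A' →ₗ[R] A) (f : K →ₗ[R] L) (i : ℕ) (e : EE R A K i) :
    epre L t i (epost A f i e) = epost A' f i (epre K t i e) := by
  simp only [epost_apply, epre_apply]
  rw [Ext.comp_assoc_of_third_deg_zero]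

lemma epre_smul (r : R) (t : A' →ₗ[R] A) (i : ℕ) : epre K (r • t) i = r • epre K t i := by
  ext e
  simp only [epre_apply, LinearMap.smul_apply]
  rw [← Ext.smul_comp, ← Ext.mk₀_smul]
  rfl

lemma epre_zero (i : ℕ) : epre K (0 : A' →ₗ[R] A) i = 0 := by
  have := epre_smul (K := K) (0 : R) (0 : A' →ₗ[R] A) i
  simpa using this

lemma epre_id (i : ℕ) (e : EE R A K i) : epre K (LinearMap.id : A →ₗ[R] A) i e = e := by
  rw [epre_apply]
  exact Ext.mk₀_id_comp e

/-- Elements killing `A` kill Ext. -/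
lemma smul_EE (r : R) (hr : ∀ a : A, r • a = 0) (i : ℕ) (e : EE R A K i) : r • e = 0 := by
  have h : (r • LinearMap.id : A →ₗ[R] A) = 0 := by ext a; simpa using hr a
  have h2 := LinearMap.congr_fun (epre_smul (K := K) r (LinearMap.id : A →ₗ[R] A) i) e
  rw [h, epre_zero, LinearMap.smul_apply, epre_id] at h2
  simpa using h2.symm

/-- Elements killing `K` kill Ext. -/
lemma smul_EE' (r : R) (hr : ∀ a : K, r • a = 0) (i : ℕ) (e : EE R A K i) : r • e = 0 := by
  have h : (r • LinearMap.id : K →ₗ[R] K) = 0 := by ext a; simpa using hr a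
  have h2 := LinearMap.congr_fun (epost_smul (A := A) r (LinearMap.id : K →ₗ[R] K) i) e
  rw [h, epost_zero, LinearMap.smul_apply, epost_id] at h2
  simpa using h2.symm

/-- equivalences induce equivalences -/
noncomputable def epostEquiv (f : K ≃ₗ[R] L) (i : ℕ) : EE R A K i ≃ₗ[R] EE R A L i :=
  LinearEquiv.ofLinearMap (epost A f.toLinearMap i) (epost A f.symm.toLinearMap i)
    (by ext e; simp [← epost_comp, epost_id])
    (by ext e; simp [← epost_comp, epost_id])

section SES

variable (f : K →ₗ[R] L) (g : L →ₗ[R] N) (hf : Function.Injective f) (hfg : Function.Exact f g)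
  (hg : Function.Surjective g)

include hf hfg hg in
lemma sesExact : (ShortComplex.mk (ModuleCat.ofHom f) (ModuleCat.ofHom g)
    (by ext x; simpa using hfg.apply_apply_eq_zero x)).ShortExact :=
  ModuleCat.shortComplex_shortExact _ hfg hf hg

variable (A) in
/-- connecting map -/
noncomputable def edelta (i : ℕ) : EE R A N i →ₗ[R] EE R A K (i+1) :=
  (Ext.bilinearCompOfLinear R (ModuleCat.of R A) (ModuleCat.of R N) (ModuleCat.of R K) i 1 (i+1)
    rfl).flip (sesExact f g hf hfg hg).extClass

lemma edelta_apply (i : ℕ) (e : EE R A N i) :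
    edelta A f g hf hfg hg i e = Ext.comp e (sesExact f g hf hfg hg).extClass rfl := rfl

lemma epre_edelta (t : A' →ₗ[R] A) (i : ℕ) (e : EE R A N i) :
    epre K t (i+1) (edelta A f g hf hfg hg i e) = edelta A' f g hf hfg hg i (epre N t i e) := by
  simp only [edelta_apply, epre_apply]
  exact (Ext.comp_assoc _ _ _ (zero_add i) rfl (by lia)).symm

include hf hfg hg in
lemma les2 (i : ℕ) : Function.Exact (epost A f i) (epost A g i) := by
  intro e
  constructor
  · intro h
    obtain ⟨x, hx⟩ := Ext.covariant_sequence_exact₂ (ModuleCat.of R A) (sesExact f g hf hfg hg) e h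
    exact ⟨x, hx⟩
  · rintro ⟨x, rfl⟩
    rw [← epost_comp, hfg.linearMap_comp_eq_zero, epost_zero, LinearMap.zero_apply]

lemma les3 (i : ℕ) : Function.Exact (epost A g i) (edelta A f g hf hfg hg i) := by
  intro e
  constructor
  · intro h
    obtain ⟨x, hx⟩ := Ext.covariant_sequence_exact₃ (ModuleCat.of R A) (sesExact f g hf hfg hg) e rfl h
    exact ⟨x, hx⟩
  · rintro ⟨x, rfl⟩
    rw [edelta_apply, epost_apply]
    have := (sesExact f g hf hfg hg).comp_extClass
    rw [Ext.comp_assoc_of_second_deg_zero]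
    exact (congrArg (fun t => Ext.comp x t rfl) this).trans (Ext.comp_zero ..)

lemma les1 (i : ℕ) : Function.Exact (edelta A f g hf hfg hg i) (epost A f (i+1)) := by
  intro e
  constructor
  · intro h
    obtain ⟨x, hx⟩ := Ext.covariant_sequence_exact₁ (ModuleCat.of R A) (sesExact f g hf hfg hg) e h rfl
    exact ⟨x, hx⟩
  · rintro ⟨x, rfl⟩
    rw [edelta_apply, epost_apply]
    have := (sesExact f g hf hfg hg).extClass_comp
    rw [Ext.comp_assoc_of_third_deg_zero]
    exact (congrArg (fun t => Ext.comp x t rfl) this).trans (Ext.comp_zero ..)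

variable (A) in
/-- contravariant connecting map -/
noncomputable def cdelta (i : ℕ) : EE R K A i →ₗ[R] EE R N A (i+1) :=
  (Ext.bilinearCompOfLinear R (ModuleCat.of R N) (ModuleCat.of R K) (ModuleCat.of R A) 1 i (i+1)
    (add_comm _ _)) (sesExact f g hf hfg hg).extClass

lemma cdelta_apply (i : ℕ) (e : EE R K A i) :
    cdelta A f g hf hfg hg i e = (sesExact f g hf hfg hg).extClass.comp e (add_comm _ _) := rfl

include hf hfg hg in
variable (A) in
lemma cles2 (i : ℕ) : Function.Exact (epre A g i) (epre A f i) := by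
  intro e
  constructor
  · intro h
    obtain ⟨x, hx⟩ := Ext.contravariant_sequence_exact₂ (sesExact f g hf hfg hg) (ModuleCat.of R A) e h
    exact ⟨x, hx⟩
  · rintro ⟨x, rfl⟩
    simp only [epre_apply]
    rw [Ext.mk₀_comp_mk₀_assoc]
    have : ModuleCat.ofHom f ≫ ModuleCat.ofHom g = 0 := by
      ext x; simpa using hfg.apply_apply_eq_zero x
    rw [this]; simp

variable (A) in
lemma cles1 (i : ℕ) : Function.Exact (epre A f i) (cdelta A f g hf hfg hg i) := by
  intro e
  constructor
  · intro h
    obtain ⟨x, hx⟩ := Ext.contravariant_sequence_exact₁ (sesExact f g hf hfg hg) (ModuleCat.of R A) e (add_comm 1 i) h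
    exact ⟨x, hx⟩
  · rintro ⟨x, rfl⟩
    rw [cdelta_apply, epre_apply]
    exact (sesExact f g hf hfg hg).extClass_comp_assoc x

variable (A) in
lemma cles3 (i : ℕ) : Function.Exact (cdelta A f g hf hfg hg i) (epre A g (i+1)) := by
  intro e
  constructor
  · intro h
    obtain ⟨x, hx⟩ := Ext.contravariant_sequence_exact₃ (sesExact f g hf hfg hg) (ModuleCat.of R A) e h (add_comm 1 i)
    exact ⟨x, hx⟩
  · rintro ⟨x, rfl⟩
    rw [cdelta_apply, epre_apply]
    exact (sesExact f g hf hfg hg).comp_extClass_assoc x (add_comm 1 i)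

end SES

lemma epost_inj0 (f : K →ₗ[R] L) (hf : Function.Injective f) : Function.Injective (epost A f 0) := by
  have : Mono (ModuleCat.ofHom f) := (ModuleCat.mono_iff_injective _).2 hf
  exact Ext.postcomp_mk₀_injective_of_mono (ModuleCat.of R A) (ModuleCat.ofHom f)

lemma epre_inj0 (g : A' →ₗ[R] A) (hg : Function.Surjective g) :
    Function.Injective (epre K g 0) := by
  have : Epi (ModuleCat.ofHom g) := (ModuleCat.epi_iff_surjective _).2 hg
  exact Ext.precomp_mk₀_injective_of_epi (ModuleCat.of R K) (ModuleCat.ofHom g)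

variable (A K) in
/-- degree zero Ext -/
noncomputable def e0 : EE R A K 0 ≃ₗ[R] (A →ₗ[R] K) :=
  Ext.linearEquiv₀ (R := R) |>.trans ModuleCat.homLinearEquiv

lemma e0_symm_apply (φ : A →ₗ[R] K) : (e0 A K).symm φ = Ext.mk₀ (ModuleCat.ofHom φ) := rfl

lemma e0_epost (f : K →ₗ[R] L) (e : EE R A K 0) : e0 A L (epost A f 0 e) = f ∘ₗ e0 A K e := by
  obtain ⟨φ, rfl⟩ := (e0 A K).symm.surjective e
  rw [LinearEquiv.apply_symm_apply, ← LinearEquiv.eq_symm_apply, e0_symm_apply, e0_symm_apply,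
    epost_apply]
  exact Ext.mk₀_comp_mk₀ _ _

lemma e0_epre (t : A' →ₗ[R] A) (e : EE R A K 0) : e0 A' K (epre K t 0 e) = e0 A K e ∘ₗ t := by
  obtain ⟨φ, rfl⟩ := (e0 A K).symm.surjective e
  rw [LinearEquiv.apply_symm_apply, ← LinearEquiv.eq_symm_apply, e0_symm_apply, e0_symm_apply,
    epre_apply]
  exact Ext.mk₀_comp_mk₀ _ _

end Toolkit

end CofPf

namespace CofPf

section FinTools

set_option linter.unusedSectionVars false

variable {R : Type u} [CommRing R] [IsNoetherianRing R]

lemma fin_of_exact {A B C : Type*} [AddCommGroup A] [Module R A] [AddCommGroup B] [Module R B]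
    [AddCommGroup C] [Module R C] {f : A →ₗ[R] B} {g : B →ₗ[R] C} (h : Function.Exact f g)
    (hA : Module.Finite R A) (hC : Module.Finite R C) : Module.Finite R B := by
  have : IsNoetherian R A := inferInstance
  have : IsNoetherian R C := inferInstance
  have := isNoetherian_of_range_eq_ker f g h.linearMap_ker_eq.symm
  infer_instance

lemma fin_of_inj {A B : Type*} [AddCommGroup A] [Module R A] [AddCommGroup B] [Module R B]
    {f : A →ₗ[R] B} (h : Function.Injective f) (hB : Module.Finite R B) : Module.Finite R A :=
  Module.Finite.of_injective f h

variable (A : Type u) [AddCommGroup A] [Module R A]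
variable {K L N : Type u} 
  [AddCommGroup K] [Module R K] [AddCommGroup L] [Module R L] [AddCommGroup N] [Module R N]

/-- `Ext^i(A,K)` is finitely generated -/
def FE (A K : Type u) [AddCommGroup A] [Module R A] [AddCommGroup K] [Module R K] (i : ℕ) : Prop :=
  Module.Finite R (EE R A K i)

variable {A}
section
variable (f : K →ₗ[R] L) (g : L →ₗ[R] N) (hf : Function.Injective f) (hfg : Function.Exact f g)
  (hg : Function.Surjective g)

include hf hfg hg

lemma FE.mid {i : ℕ} (h1 : FE (R := R) A K i) (h2 : FE (R := R) A N i) : FE (R := R) A L i :=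
  fin_of_exact (les2 f g hf hfg hg i) h1 h2

lemma FE.right {i : ℕ} (h1 : FE (R := R) A L i) (h2 : FE (R := R) A K (i+1)) :
    FE (R := R) A N i :=
  fin_of_exact (les3 f g hf hfg hg i) h1 h2

lemma FE.left {i : ℕ} (h1 : FE (R := R) A N i) (h2 : FE (R := R) A L (i+1)) :
    FE (R := R) A K (i+1) :=
  fin_of_exact (les1 f g hf hfg hg i) h1 h2

end

lemma FE.left0 (f : K →ₗ[R] L) (hf : Function.Injective f) (h : FE (R := R) A L 0) :
    FE (R := R) A K 0 :=
  fin_of_inj (epost_inj0 f hf) h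

lemma FE.equiv (f : K ≃ₗ[R] L) {i : ℕ} (h : FE (R := R) A K i) : FE (R := R) A L i := by
  unfold FE at *
  exact Module.Finite.equiv (epostEquiv f i)

lemma FE.of_fin [Module.Finite R A] [Module.Finite R K] (i : ℕ) : FE (R := R) A K i :=
  ModuleCat.finite_ext.{u} (R := R) (ModuleCat.of R A) (ModuleCat.of R K) i

/-- all Ext's from R/I finite -/
def Cof (I : Ideal R) (K : Type u) [AddCommGroup K] [Module R K] : Prop :=
  ∀ i, FE (R := R) (R ⧸ I) K i

variable {I : Ideal R}

section
variable (f : K →ₗ[R] L) (g : L →ₗ[R] N) (hf : Function.Injective f) (hfg : Function.Exact f g)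
  (hg : Function.Surjective g)

include hf hfg hg

lemma Cof.mid (h1 : Cof I K) (h2 : Cof I N) : Cof I L :=
  fun i => FE.mid f g hf hfg hg (h1 i) (h2 i)

lemma Cof.right (h1 : Cof I K) (h2 : Cof I L) : Cof I N :=
  fun i => FE.right f g hf hfg hg (h2 i) (h1 (i+1))

lemma Cof.left (h1 : Cof I L) (h2 : Cof I N) : Cof I K := by
  intro i
  cases i with
  | zero => exact FE.left0 f hf (h1 0)
  | succ i => exact FE.left f g hf hfg hg (h2 i) (h1 (i+1))

end

lemma Cof.equiv (f : K ≃ₗ[R] L) (h : Cof I K) : Cof I L := fun i => FE.equiv f (h i)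

lemma Cof.of_fin [Module.Finite R K] : Cof I K := fun i => FE.of_fin i

lemma Cof.of_subsingleton [Subsingleton K] : Cof I K := Cof.of_fin

/-- the elements killed by I -/
def an {R : Type u} [CommRing R] (I : Ideal R) (K : Type u) [AddCommGroup K] [Module R K] : Submodule R K where
  carrier := {k | ∀ a ∈ I, a • k = 0}
  add_mem' {x y} hx hy a ha := by rw [smul_add, hx a ha, hy a ha, add_zero]
  zero_mem' a _ := smul_zero a
  smul_mem' r x hx a ha := by rw [smul_comm, hx a ha, smul_zero]

omit [IsNoetherianRing R] in
lemma mem_an {k : K} : k ∈ an I K ↔ ∀ a ∈ I, a • k = 0 := Iff.rfl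

/-- Hom, with instances going through additive groups -/
abbrev HomM (R A K : Type u) [CommRing R] [AddCommGroup A] [Module R A] [AddCommGroup K]
    [Module R K] : Type u := A →ₗ[R] K

/-- Hom(R/I,K) -/
noncomputable def homAn {R : Type u} [CommRing R] (I : Ideal R) (K : Type u) [AddCommGroup K]
    [Module R K] : HomM R (R ⧸ I) K ≃ₗ[R] an I K where
  toFun φ := ⟨φ 1, fun a ha => by
    rw [← map_smul]
    have : a • (1 : R ⧸ I) = 0 := by
      rw [← map_one (Ideal.Quotient.mk I), ← Ideal.Quotient.mk_eq_mk, ← Submodule.Quotient.mk_smul]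
      simpa [Ideal.Quotient.eq_zero_iff_mem] using ha
    rw [this, map_zero]⟩
  map_add' φ ψ := rfl
  map_smul' r φ := rfl
  invFun k := Submodule.liftQ I (LinearMap.toSpanSingleton R K k.1) (fun a ha => k.2 a ha)
  left_inv φ := by
    ext
    change (1:R) • φ 1 = φ 1
    rw [one_smul]
  right_inv k := by
    ext
    change (1:R) • k.1 = k.1
    rw [one_smul]

/-- degree 0 Ext. -/
lemma FE0_iff : FE (R := R) (R ⧸ I) K 0 ↔ Module.Finite R (an I K) := by
  have e : EE R (R ⧸ I) K 0 ≃ₗ[R] an I K := (e0 (R := R) (R ⧸ I) K).trans (homAn I K)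
  constructor
  · intro h
    have h' : Module.Finite R (EE R (R ⧸ I) K 0) := h
    exact Module.Finite.of_surjective e.toLinearMap e.surjective
  · intro h
    have h' : Module.Finite R (EE R (R ⧸ I) K 0) :=
      Module.Finite.of_surjective e.symm.toLinearMap e.symm.surjective
    exact h'

/-- I-torsion module -/
def Tors (I : Ideal R) (K : Type u) [AddCommGroup K] [Module R K] : Prop :=
  ∀ k : K, ∃ n : ℕ, ∀ a ∈ I ^ n, a • k = 0

omit [IsNoetherianRing R] in
lemma Tors.of_inj (f : K →ₗ[R] L) (hf : Function.Injective f) (h : Tors I L) : Tors I K := by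
  intro k
  obtain ⟨n, hn⟩ := h (f k)
  exact ⟨n, fun a ha => hf (by rw [map_smul, hn a ha, map_zero])⟩

omit [IsNoetherianRing R] in
lemma Tors.of_surj (f : K →ₗ[R] L) (hf : Function.Surjective f) (h : Tors I K) : Tors I L := by
  intro k
  obtain ⟨k, rfl⟩ := hf k
  obtain ⟨n, hn⟩ := h k
  exact ⟨n, fun a ha => (by rw [← map_smul, hn a ha, map_zero])⟩

omit [IsNoetherianRing R] in
lemma Tors.support (h : Tors I K) : Module.support R K ⊆ PrimeSpectrum.zeroLocus (I : Set R) := by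
  intro p hp
  rw [Module.mem_support_iff_exists_annihilator] at hp
  obtain ⟨m, hm⟩ := hp
  obtain ⟨n, hn⟩ := h m
  rw [PrimeSpectrum.mem_zeroLocus]
  have h1 : I ^ n ≤ p.asIdeal := by
    refine le_trans ?_ hm
    intro a ha
    rw [Submodule.mem_annihilator_span_singleton]
    exact hn a ha
  exact Ideal.IsPrime.le_of_pow_le h1

omit [IsNoetherianRing R] in
/-- In a torsion module, no elements killed by I implies zero -/
lemma Tors.eq_zero_of_an (h : Tors I K) (h0 : ∀ k ∈ an I K, k = 0) (k : K) : k = 0 := by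
  obtain ⟨n, hn⟩ := h k
  induction n generalizing k with
  | zero => simpa using hn 1 (by simp)
  | succ n ih =>
    apply ih
    intro a ha
    apply h0
    intro b hb
    rw [← mul_smul]
    apply hn
    rw [pow_succ, mul_comm b a]
    exact Ideal.mul_mem_mul ha hb

end FinTools

end CofPf

namespace CofPf

section Devissage

set_option linter.unusedSectionVars false

variable {R : Type u} [CommRing R] [IsNoetherianRing R]

/-- dévissage for a class of modules closed under middle of exact sequences -/
lemma devissage (S : ∀ (X : Type u) [AddCommGroup X] [Module R X], Prop)
    (hmid : ∀ (A B C : Type u) [AddCommGroup A] [Module R A] [AddCommGroup B] [Module R B]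
      [AddCommGroup C] [Module R C] (f : A →ₗ[R] B) (g : B →ₗ[R] C), Function.Exact f g →
      S A → S C → S B)
    (h0 : S PUnit.{u+1}) (I : Ideal R) (K : Type u) [AddCommGroup K] [Module R K] (k : ℕ)
    (h : ∀ i ≤ k, S (EE R (R ⧸ I) K i)) (i : ℕ) (hi : i ≤ k) (N : Type u) [AddCommGroup N]
    [Module R N] [Module.Finite R N] (hN : Tors I N) : S (EE R N K i) := by
  have hinj : ∀ (B C : Type u) [AddCommGroup B] [Module R B]
      [AddCommGroup C] [Module R C] (g : B →ₗ[R] C), Function.Injective g → S C → S B := by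
    intro B C _ _ _ _ g hg hC
    refine hmid PUnit.{u+1} B C 0 g ?_ h0 hC
    intro y
    constructor
    · intro hy; exact ⟨0, by rw [map_zero]; exact (hg (by rw [hy, map_zero])).symm⟩
    · rintro ⟨x, rfl⟩; simp
  have hsub : ∀ (B : Type u) [AddCommGroup B] [Module R B], Subsingleton B → S B := by
    intro B _ _ hB
    exact hinj B PUnit.{u+1} 0 (fun x y _ => Subsingleton.elim x y) h0
  revert hN
  suffices hs : ∀ i ≤ k, ∀ (N : Type u) [AddCommGroup N] [Module R N] [Module.Finite R N],
      Tors I N → S (EE R N K i) from hs i hi N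
  clear hi i
  intro i
  induction i with
  | zero =>
    intro hi N _ _ hfin
    refine IsNoetherianRing.induction_on_isQuotientEquivQuotientPrime R hfin
      (motive := fun N _ _ _ => Tors I N → S (EE R N K 0)) ?_ ?_ ?_
    · intro N _ _ _ _ _
      apply hsub
      refine (e0 N K).injective.subsingleton
    · intro N _ _ _ p e hT
      have hle : I ≤ p.1 := by
        have := Tors.of_surj e.toLinearMap e.surjective hT
        obtain ⟨n, hn⟩ := this (Ideal.Quotient.mk p.1 1)
        refine Ideal.IsPrime.le_of_pow_le (hP := p.2) (n := n) ?_
        intro a ha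
        have := hn a ha
        rw [← Ideal.Quotient.eq_zero_iff_mem]
        rw [← Ideal.Quotient.mk_eq_mk, ← Submodule.Quotient.mk_smul] at this
        simpa using this
      let q : (R ⧸ I) →ₗ[R] N := e.symm.toLinearMap ∘ₗ Submodule.mapQ I p.1 LinearMap.id hle
      have hq : Function.Surjective q := by
        refine e.symm.surjective.comp ?_
        intro x
        obtain ⟨x, rfl⟩ := Submodule.Quotient.mk_surjective _ x
        exact ⟨Submodule.Quotient.mk x, rfl⟩
      exact hinj _ _ (epre K q 0) (epre_inj0 q hq) (h 0 (Nat.zero_le _))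
    · intro N1 _ _ _ N2 _ _ _ N3 _ _ _ f g hf hg hfg h1 h3 hT
      exact hmid _ _ _ _ _ (cles2 K f g hf hfg hg 0) (h3 (hT.of_surj g hg)) (h1 (hT.of_inj f hf))
  | succ i ih =>
    intro hi N _ _ hfin
    refine IsNoetherianRing.induction_on_isQuotientEquivQuotientPrime R hfin
      (motive := fun N _ _ _ => Tors I N → S (EE R N K (i+1))) ?_ ?_ ?_
    · intro N _ _ _ _ _
      apply hsub
      constructor
      intro x y
      have hid : (LinearMap.id : N →ₗ[R] N) = 0 := by ext x; exact Subsingleton.elim _ _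
      rw [← epre_id _ x, ← epre_id _ y, hid, epre_zero]; rfl
    · intro N _ _ _ p e hT
      have hle : I ≤ p.1 := by
        have := Tors.of_surj e.toLinearMap e.surjective hT
        obtain ⟨n, hn⟩ := this (Ideal.Quotient.mk p.1 1)
        refine Ideal.IsPrime.le_of_pow_le (hP := p.2) (n := n) ?_
        intro a ha
        have := hn a ha
        rw [← Ideal.Quotient.eq_zero_iff_mem]
        rw [← Ideal.Quotient.mk_eq_mk, ← Submodule.Quotient.mk_smul] at this
        simpa using this
      let q : (R ⧸ I) →ₗ[R] N := e.symm.toLinearMap ∘ₗ Submodule.mapQ I p.1 LinearMap.id hle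
      have hq : Function.Surjective q := by
        refine e.symm.surjective.comp ?_
        intro x
        obtain ⟨x, rfl⟩ := Submodule.Quotient.mk_surjective _ x
        exact ⟨Submodule.Quotient.mk x, rfl⟩
      have hTI : Tors I (R ⧸ I) := by
        intro x
        obtain ⟨x, rfl⟩ := Submodule.Quotient.mk_surjective _ x
        refine ⟨1, fun a ha => ?_⟩
        rw [← Submodule.Quotient.mk_smul, Submodule.Quotient.mk_eq_zero]
        rw [pow_one] at ha
        exact I.mul_mem_right x ha
      have hker := ih (by lia) (LinearMap.ker q) (hTI.of_inj (LinearMap.ker q).subtype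
        (Submodule.subtype_injective _))
      exact hmid _ _ _ _ _ (cles3 K (LinearMap.ker q).subtype q (Submodule.subtype_injective _)
        (LinearMap.exact_subtype_ker_map q) hq i) hker (h _ hi)
    · intro N1 _ _ _ N2 _ _ _ N3 _ _ _ f g hf hg hfg h1 h3 hT
      exact hmid _ _ _ _ _ (cles2 K f g hf hfg hg _) (h3 (hT.of_surj g hg)) (h1 (hT.of_inj f hf))

variable {K L N : Type u} 
  [AddCommGroup K] [Module R K] [AddCommGroup L] [Module R L] [AddCommGroup N] [Module R N]

lemma devissage_fin (I : Ideal R) (k : ℕ)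
    (h : ∀ i ≤ k, FE (R := R) (R ⧸ I) K i) (i : ℕ) (hi : i ≤ k) [Module.Finite R N]
    (hN : Tors I N) : FE (R := R) N K i := by
  unfold FE
  exact devissage (fun X _ _ => Module.Finite R X)
    (by intro A B C _ _ _ _ _ _ f g hfg hA hC; exact fin_of_exact hfg hA hC)
    (by infer_instance) I K k (fun i hi => by have := h i hi; unfold FE at this; exact this) i hi N hN

/-- all Ext's from R/I vanish -/
def VE (I : Ideal R) (K : Type u) [AddCommGroup K] [Module R K] : Prop :=
  ∀ i, Subsingleton (EE R (R ⧸ I) K i)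

lemma devissage_sub (I : Ideal R) (h : VE I K) (i : ℕ) [Module.Finite R N]
    (hN : Tors I N) : Subsingleton (EE R N K i) :=
  devissage (fun X _ _ => Subsingleton X)
    (by
      intro A B C _ _ _ _ _ _ f g hfg hA hC
      constructor
      intro x y
      have hz : ∀ x : B, x = 0 := by
        intro x
        obtain ⟨a, rfl⟩ := (hfg x).1 (Subsingleton.elim _ _)
        rw [Subsingleton.elim a 0, map_zero]
      rw [hz x, hz y])
    (by infer_instance) I K i (fun i _ => h i) i le_rfl N hN

lemma Tors.quot_pow (I : Ideal R) (n : ℕ) : Tors I (R ⧸ I ^ n) := by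
  intro x
  obtain ⟨x, rfl⟩ := Submodule.Quotient.mk_surjective _ x
  refine ⟨n, fun a ha => ?_⟩
  rw [← Submodule.Quotient.mk_smul, Submodule.Quotient.mk_eq_zero]
  exact (I ^ n).mul_mem_right x ha

/-- The torsion submodule. -/
def Gam (I : Ideal R) (K : Type u) [AddCommGroup K] [Module R K] : Submodule R K where
  carrier := {k | ∃ n : ℕ, ∀ a ∈ I ^ n, a • k = 0}
  add_mem' := by
    rintro x y ⟨n, hn⟩ ⟨m, hm⟩
    refine ⟨n + m, fun a ha => ?_⟩
    rw [smul_add, hn a (Ideal.pow_le_pow_right (by lia) ha),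
      hm a (Ideal.pow_le_pow_right (by lia) ha), add_zero]
  zero_mem' := ⟨0, fun a _ => smul_zero a⟩
  smul_mem' := by
    rintro r x ⟨n, hn⟩
    exact ⟨n, fun a ha => by rw [smul_comm, hn a ha, smul_zero]⟩

lemma mem_Gam {I : Ideal R} {k : K} : k ∈ Gam I K ↔ ∃ n : ℕ, ∀ a ∈ I ^ n, a • k = 0 := Iff.rfl

lemma Tors.Gam (I : Ideal R) : Tors I (Gam I K) := by
  rintro ⟨k, n, hn⟩
  exact ⟨n, fun a ha => by ext; exact hn a ha⟩

/-- A finitely generated submodule of torsion elements is killed by a power. -/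
lemma exists_pow_kill {I : Ideal R} (N : Submodule R K) (hN : N.FG) (h : N ≤ Gam I K) :
    ∃ n : ℕ, ∀ a ∈ I ^ n, ∀ x ∈ N, a • x = 0 := by
  classical
  obtain ⟨s, rfl⟩ := hN
  induction s using Finset.induction_on with
  | empty => exact ⟨0, by simp⟩
  | insert x s hx ih =>
    obtain ⟨n, hn⟩ := ih (le_trans (Submodule.span_mono (by simp)) h)
    obtain ⟨m, hm⟩ := h (Submodule.subset_span (by simp : x ∈ _))
    refine ⟨n + m, fun a ha y hy => ?_⟩
    rw [Finset.coe_insert, Submodule.mem_span_insert] at hy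
    obtain ⟨r, z, hz, rfl⟩ := hy
    rw [smul_add, smul_comm, hm a (Ideal.pow_le_pow_right (by lia) ha),
      hn a (Ideal.pow_le_pow_right (by lia) ha) z hz, smul_zero, add_zero]

/-- K has no elements killed by I -/
def TF (I : Ideal R) (K : Type u) [AddCommGroup K] [Module R K] : Prop :=
  ∀ k ∈ an I K, k = 0

lemma TF.quot_Gam (I : Ideal R) : TF I (K ⧸ Gam I K) := by
  intro k hk
  obtain ⟨k, rfl⟩ := Submodule.Quotient.mk_surjective _ k
  rw [Submodule.Quotient.mk_eq_zero]
  have h1 : Submodule.map (LinearMap.toSpanSingleton R K k) I ≤ Gam I K := by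
    rintro _ ⟨a, ha, rfl⟩
    have := hk a ha
    rwa [← Submodule.Quotient.mk_smul, Submodule.Quotient.mk_eq_zero] at this
  obtain ⟨n, hn⟩ := exists_pow_kill _ ((IsNoetherian.noetherian I).map _) h1
  refine ⟨n + 1, ?_⟩
  intro a ha
  rw [pow_succ] at ha
  refine Submodule.mul_induction_on ha ?_ ?_
  · intro b hb c hc
    rw [mul_smul]
    exact hn b hb _ ⟨c, hc, rfl⟩
  · intro x y hx hy
    rw [add_smul, hx, hy, add_zero]

lemma TF.gam {I : Ideal R} (h : TF I K) : Gam I K = ⊥ := by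
  rw [eq_bot_iff]
  intro k hk
  have := Tors.eq_zero_of_an (Tors.Gam (K := K) I) (k := ⟨k, hk⟩)
    (fun x hx => by ext; exact h x.1 (fun a ha => congrArg Subtype.val (hx a ha)))
  exact congrArg Subtype.val this

lemma TF.iff_sub {I : Ideal R} : TF I K ↔ Subsingleton (EE R (R ⧸ I) K 0) := by
  have e : EE R (R ⧸ I) K 0 ≃ₗ[R] an I K := (e0 (R := R) (R ⧸ I) K).trans (homAn I K)
  rw [e.toEquiv.subsingleton_congr]
  constructor
  · intro h
    exact ⟨fun x y => by ext; rw [h x x.2, h y y.2]⟩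
  · intro h k hk
    exact congrArg Subtype.val (Subsingleton.elim (⟨k, hk⟩ : an I K) 0)

lemma Gam_injective (I : Ideal R) (E : Type u) [AddCommGroup E] [Module R E]
    (hE : Module.Injective R E) : Module.Injective R (Gam I E) := by
  apply Module.Baer.injective
  intro J φ
  have hJ : (LinearMap.range ((Gam I E).subtype ∘ₗ φ)).FG := by
    rw [LinearMap.range_eq_map]
    exact (IsNoetherian.noetherian _).map _
  obtain ⟨n, hn⟩ := exists_pow_kill (I := I) _ hJ (by rintro _ ⟨x, rfl⟩; exact (φ x).2)
  obtain ⟨k, hk⟩ := Ideal.exists_pow_inf_eq_pow_smul I (J : Submodule R R)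
  have h1 := hk (n + k) (by lia)
  have hkill : ∀ x : J, x.1 ∈ I ^ (n + k) → φ x = 0 := by
    intro x hx
    have hx2 : x.1 ∈ I ^ n • J := by
      have : x.1 ∈ (I ^ (n + k) • (⊤ : Submodule R R) ⊓ J) := ⟨by simpa using hx, x.2⟩
      rw [h1, Nat.add_sub_cancel] at this
      exact (Submodule.smul_mono le_rfl inf_le_right : _ ≤ _) this
    have hx3 : x ∈ I ^ n • (⊤ : Submodule R J) := by
      have : x.1 ∈ Submodule.map J.subtype (I ^ n • (⊤ : Submodule R J)) := by
        rw [Submodule.map_smul'']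
        simpa using hx2
      obtain ⟨y, hy, hyx⟩ := this
      rwa [← Subtype.ext hyx]
    refine Submodule.smul_induction_on hx3 ?_ ?_
    · intro a ha y _
      rw [map_smul]
      ext
      exact hn a ha _ ⟨y, rfl⟩
    · intro y z hy hz
      rw [map_add, hy, hz, add_zero]
  -- the map R/I^(n+k) ⊇ image of J
  let q : R →ₗ[R] (R ⧸ I ^ (n + k)) := Submodule.mkQ _
  let qJ : J →ₗ[R] Submodule.map q J := q.submoduleMap J
  have hqJ : Function.Surjective qJ := q.submoduleMap_surjective J
  have hker : LinearMap.ker qJ ≤ LinearMap.ker ((Gam I E).subtype ∘ₗ φ) := by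
    intro x hx
    have : q x.1 = 0 := congrArg Subtype.val hx
    have h2 : x.1 ∈ I ^ (n + k) := (Submodule.Quotient.mk_eq_zero _).1 this
    rw [LinearMap.mem_ker, LinearMap.comp_apply, hkill x h2]; simp
  let ψ0 : (Submodule.map q J) →ₗ[R] E :=
    (Submodule.liftQ _ _ hker) ∘ₗ (qJ.quotKerEquivOfSurjective hqJ).symm.toLinearMap
  have hψ0 : ∀ x : J, ψ0 (qJ x) = (φ x).1 := by
    intro x
    have : (qJ.quotKerEquivOfSurjective hqJ).symm (qJ x) = Submodule.Quotient.mk x := by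
      rw [LinearEquiv.symm_apply_eq]; rfl
    simp only [ψ0, LinearMap.comp_apply, LinearEquiv.coe_coe, this]
    rfl
  obtain ⟨ψ, hψ⟩ := hE.out (Submodule.map q J).subtype (Submodule.subtype_injective _) ψ0
  have hmem : ∀ r, (ψ ∘ₗ q) r ∈ Gam I E := by
    intro r
    refine ⟨n + k, fun a ha => ?_⟩
    rw [← map_smul, LinearMap.comp_apply]
    have : q (a • r) = 0 := (Submodule.Quotient.mk_eq_zero _).2 (Ideal.mul_mem_right r _ ha)
    rw [this, map_zero]
  refine ⟨(ψ ∘ₗ q).codRestrict _ hmem, ?_⟩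
  intro x hx
  ext
  have h3 := hψ (qJ ⟨x, hx⟩)
  rw [hψ0] at h3
  exact h3

lemma EE_inj_zero (E : Type u) [AddCommGroup E] [Module R E]
    (hE : Module.Injective R E) (A : Type u) [AddCommGroup A] [Module R A] (i : ℕ) :
    Subsingleton (EE R A E (i+1)) := by
  have := Module.injective_object_of_injective_module R E
  exact ⟨fun x y => by
    rw [Abelian.Ext.eq_zero_of_injective x, Abelian.Ext.eq_zero_of_injective y]⟩

variable (R) in
lemma exists_inj (M : Type u) [AddCommGroup M] [Module R M] :
    ∃ (E : Type u) (_ : AddCommGroup E) (_ : Module R E) (f : M →ₗ[R] E),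
      Module.Injective R E ∧ Function.Injective f := by
  let P := Classical.choice (EnoughInjectives.presentation (ModuleCat.of R M))
  refine ⟨P.J, inferInstance, inferInstance, P.f.hom, ?_, ?_⟩
  · have : Injective (ModuleCat.of R P.J) := P.injective
    exact Module.injective_module_of_injective_object R P.J
  · exact (ModuleCat.mono_iff_injective _).1 P.mono

lemma exact_mkQ (N : Submodule R K) : Function.Exact N.subtype N.mkQ := by
  intro x; simp

lemma exists_sigma {I : Ideal R} (M : Type u) [AddCommGroup M] [Module R M] (hM : TF I M) :
    ∃ (E : Type u) (_ : AddCommGroup E) (_ : Module R E) (f : M →ₗ[R] E),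
      VE I E ∧ Function.Injective f := by
  obtain ⟨E, _, _, f, hE, hf⟩ := exists_inj R M
  refine ⟨E ⧸ Gam I E, inferInstance, inferInstance, (Gam I E).mkQ ∘ₗ f, ?_, ?_⟩
  · intro i
    cases i with
    | zero => exact TF.iff_sub.1 (TF.quot_Gam I)
    | succ i =>
      have h1 := EE_inj_zero _ (Gam_injective I E hE) (R ⧸ I) (i+1)
      have h2 := EE_inj_zero E hE (R ⧸ I) i
      have h := les3 (A := R ⧸ I) (Gam I E).subtype (Gam I E).mkQ (Submodule.subtype_injective _)
        (exact_mkQ _) (Submodule.mkQ_surjective _) (i+1)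
      have hz : ∀ x : EE R (R ⧸ I) (E ⧸ Gam I E) (i+1), x = 0 := by
        intro x
        obtain ⟨a, rfl⟩ := (h x).1 (Subsingleton.elim _ _)
        rw [Subsingleton.elim a 0, map_zero]
      exact ⟨fun x y => by rw [hz x, hz y]⟩
  · rw [← LinearMap.ker_eq_bot, eq_bot_iff]
    intro x hx
    have h1 : f x ∈ Gam I E := (Submodule.Quotient.mk_eq_zero _).1 hx
    have h2 : x ∈ Gam I M := by
      obtain ⟨n, hn⟩ := h1
      exact ⟨n, fun a ha => hf (by rw [map_smul, hn a ha, map_zero])⟩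
    rwa [hM.gam] at h2

end Devissage

end CofPf

namespace CofPf

section DLim

set_option linter.unusedSectionVars false

variable {R : Type u} [CommRing R] [IsNoetherianRing R]

/-- the `i`-th local cohomology as a direct limit -/
abbrev HH (I : Ideal R) (i : ℕ) (K : Type u) [AddCommGroup K] [Module R K] : Type u :=
  DL I i (ModuleCat.of R K)

variable {K L N : Type u} 
  [AddCommGroup K] [Module R K] [AddCommGroup L] [Module R L] [AddCommGroup N] [Module R N]

/-- transition maps -/
noncomputable def tr (I : Ideal R) {n m : ℕ} (h : n ≤ m) : (R ⧸ I ^ m) →ₗ[R] (R ⧸ I ^ n) :=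
  Submodule.mapQ (I ^ m) (I ^ n) LinearMap.id (Ideal.pow_le_pow_right h)

/-- structure maps -/
noncomputable def dlof (I : Ideal R) (i : ℕ) (K : Type u) [AddCommGroup K] [Module R K] (n : ℕ) :
    EE R (R ⧸ I ^ n) K i →ₗ[R] HH I i K :=
  Module.DirectLimit.of R ℕ (fun n => Abelian.Ext (qX I n) (ModuleCat.of R K) i)
    (fun n m h => eT I i (ModuleCat.of R K) n m h) n

variable (I : Ideal R)

lemma epre_tr_tr {i n m k : ℕ} (h : n ≤ m) (h' : m ≤ k) (e : EE R (R ⧸ I ^ n) K i) :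
    epre K (tr I h') i (epre K (tr I h) i e) = epre K (tr I (h.trans h')) i e :=
  DirectedSystem.map_map (f := fun n m h => eT I i (ModuleCat.of R K) n m h) h h' e

lemma dlof_tr {i n m : ℕ} (h : n ≤ m) (e : EE R (R ⧸ I ^ n) K i) :
    dlof I i K m (epre K (tr I h) i e) = dlof I i K n e :=
  Module.DirectLimit.of_f (f := fun n m h => eT I i (ModuleCat.of R K) n m h) (hij := h)

lemma dl_exists {i : ℕ} (x : HH I i K) : ∃ n e, dlof I i K n e = x :=
  Module.DirectLimit.exists_of x

lemma dl_zero {i n : ℕ} (e : EE R (R ⧸ I ^ n) K i) (h : dlof I i K n e = 0) :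
    ∃ m, ∃ h : n ≤ m, epre K (tr I h) i e = 0 :=
  Module.DirectLimit.of.zero_exact h

/-- maps out -/
noncomputable def dlLift {i : ℕ} (g : ∀ n, EE R (R ⧸ I ^ n) K i →ₗ[R] L)
    (hg : ∀ n m (h : n ≤ m) e, g m (epre K (tr I h) i e) = g n e) : HH I i K →ₗ[R] L :=
  Module.DirectLimit.lift R ℕ (fun n => Abelian.Ext (qX I n) (ModuleCat.of R K) i)
    (fun n m h => eT I i (ModuleCat.of R K) n m h) g hg

lemma dlLift_of {i : ℕ} (g : ∀ n, EE R (R ⧸ I ^ n) K i →ₗ[R] L)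
    (hg : ∀ n m (h : n ≤ m) e, g m (epre K (tr I h) i e) = g n e) (n : ℕ) (e) :
    dlLift I g hg (dlof I i K n e) = g n e :=
  Module.DirectLimit.lift_of _ _ _

lemma HH_tors (i : ℕ) : Tors I (HH I i K) := by
  intro x
  obtain ⟨n, e, rfl⟩ := dl_exists I x
  refine ⟨n, fun a ha => ?_⟩
  rw [← map_smul, smul_EE a ?_ i e, map_zero]
  intro x
  obtain ⟨x, rfl⟩ := Submodule.Quotient.mk_surjective _ x
  rw [← Submodule.Quotient.mk_smul, Submodule.Quotient.mk_eq_zero]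
  exact (I ^ n).mul_mem_right x ha

/-- evaluation at one -/
noncomputable def ev1 (n : ℕ) : EE R (R ⧸ I ^ n) K 0 →ₗ[R] K :=
  (LinearMap.applyₗ (R := R) (Submodule.Quotient.mk 1 : R ⧸ I ^ n)) ∘ₗ
    (e0 (R := R) (R ⧸ I ^ n) K).toLinearMap

lemma ev1_apply (n : ℕ) (e : EE R (R ⧸ I ^ n) K 0) :
    ev1 I n e = e0 (R := R) (R ⧸ I ^ n) K e (Submodule.Quotient.mk 1) := rfl

lemma ev1_tr {n m : ℕ} (h : n ≤ m) (e : EE R (R ⧸ I ^ n) K 0) :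
    ev1 I m (epre K (tr I h) 0 e) = ev1 I n e := by
  rw [ev1_apply, ev1_apply, e0_epre]
  rfl

lemma ev1_inj (n : ℕ) : Function.Injective (ev1 (K := K) I n) := by
  rw [← LinearMap.ker_eq_bot, eq_bot_iff]
  intro e he
  have he : ev1 I n e = 0 := he
  rw [ev1_apply] at he
  rw [Submodule.mem_bot, ← (e0 (R := R) (R ⧸ I ^ n) K).map_eq_zero_iff]
  ext
  exact he

lemma ev1_mem (n : ℕ) (e : EE R (R ⧸ I ^ n) K 0) : ev1 I n e ∈ Gam I K := by
  refine ⟨n, fun a ha => ?_⟩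
  rw [ev1_apply, ← map_smul, ← Submodule.Quotient.mk_smul]
  have : (Submodule.Quotient.mk (a • 1) : R ⧸ I ^ n) = 0 :=
    (Submodule.Quotient.mk_eq_zero _).2 (by simpa using ha)
  rw [this, map_zero]

lemma ev1_surj (n : ℕ) (k : K) (hk : ∀ a ∈ I ^ n, a • k = 0) : ∃ e, ev1 I n e = k := by
  let φ : (R ⧸ I ^ n) →ₗ[R] K := Submodule.liftQ (I ^ n) (LinearMap.toSpanSingleton R K k)
    (fun a ha => hk a ha)
  refine ⟨(e0 (R := R) (R ⧸ I ^ n) K).symm φ, ?_⟩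
  rw [ev1_apply, LinearEquiv.apply_symm_apply]
  change (1 : R) • k = k
  rw [one_smul]

/-- degree zero local cohomology -/
lemma K0 : Nonempty (HH I 0 K ≃ₗ[R] Gam I K) := by
  let f : HH I 0 K →ₗ[R] Gam I K := dlLift I (fun n => (ev1 I n).codRestrict _ (ev1_mem I n))
    (fun n m h e => by ext; exact ev1_tr I h e)
  have hf : ∀ n e, (f (dlof I 0 K n e)).1 = ev1 I n e := by
    intro n e
    rw [dlLift_of]; rfl
  refine ⟨LinearEquiv.ofBijective f ⟨?_, ?_⟩⟩
  · rw [← LinearMap.ker_eq_bot, eq_bot_iff]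
    intro x hx
    obtain ⟨n, e, rfl⟩ := dl_exists I x
    have h1 := hf n e
    rw [LinearMap.mem_ker.1 hx] at h1
    have : e = 0 := ev1_inj I n (by rw [← h1]; simp)
    rw [this, map_zero]; exact Submodule.zero_mem _
  · rintro ⟨k, n, hn⟩
    obtain ⟨e, he⟩ := ev1_surj I n k hn
    exact ⟨dlof I 0 K n e, by ext; rw [hf, he]⟩

section
variable (f : K →ₗ[R] L) (g : L →ₗ[R] N) (hf : Function.Injective f) (hfg : Function.Exact f g)
  (hg : Function.Surjective g)
include hf hfg hg

/-- dimension shifting -/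
lemma K1a (hL : VE I L) (i : ℕ) : Nonempty (HH I i N ≃ₗ[R] HH I (i+1) K) := by
  have hV : ∀ n j, Subsingleton (EE R (R ⧸ I ^ n) L j) := fun n j =>
    devissage_sub I hL j (Tors.quot_pow I n)
  have hinj : ∀ n, Function.Injective (edelta (R ⧸ I ^ n) f g hf hfg hg i) := by
    intro n
    rw [← LinearMap.ker_eq_bot, eq_bot_iff]
    intro x hx
    obtain ⟨y, rfl⟩ := (les3 (A := R ⧸ I ^ n) f g hf hfg hg i x).1 hx
    rw [Subsingleton.elim y 0, map_zero]; exact Submodule.zero_mem _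
  have hsurj : ∀ n, Function.Surjective (edelta (R ⧸ I ^ n) f g hf hfg hg i) := by
    intro n x
    exact (les1 (A := R ⧸ I ^ n) f g hf hfg hg i x).1 (Subsingleton.elim _ _)
  refine ⟨Module.DirectLimit.congr
    (fun n => LinearEquiv.ofBijective (edelta (R ⧸ I ^ n) f g hf hfg hg i) ⟨hinj n, hsurj n⟩) ?_⟩
  intro n m h
  ext e
  exact (epre_edelta f g hf hfg hg (tr I h) i e).symm

end

/-- higher local cohomology of a torsion module vanishes -/
lemma torsion_vanish (j : ℕ) : ∀ (N : Type u) [AddCommGroup N] [Module R N], Tors I N →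
    ∀ (n : ℕ) (e : EE R (R ⧸ I ^ n) N (j+1)), ∃ m, ∃ h : n ≤ m, epre N (tr I h) (j+1) e = 0 := by
  induction j with
  | zero =>
    intro N _ _ hN n e
    obtain ⟨E, _, _, f, hE, hf⟩ := exists_inj R N
    have hmem : ∀ x, f x ∈ Gam I E := fun x => by
      obtain ⟨n, hn⟩ := hN x
      exact ⟨n, fun a ha => by rw [← map_smul, hn a ha, map_zero]⟩
    let f' : N →ₗ[R] Gam I E := f.codRestrict _ hmem
    have hf' : Function.Injective f' := fun x y h => hf (congrArg Subtype.val h)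
    have hQ := Gam_injective I E hE
    let g := (LinearMap.range f').mkQ
    have hg : Function.Surjective g := Submodule.mkQ_surjective _
    have hfg : Function.Exact f' g := LinearMap.exact_map_mkQ_range f'
    have := EE_inj_zero _ hQ (R ⧸ I ^ n) 0
    obtain ⟨e', rfl⟩ := (les1 (A := R ⧸ I ^ n) f' g hf' hfg hg 0 e).1 (Subsingleton.elim _ _)
    obtain ⟨x, hx⟩ := hg (ev1 I n e')
    obtain ⟨m, hm⟩ := Tors.Gam (K := E) I x
    have hm' : ∀ a ∈ I ^ (n + m), a • x = 0 := fun a ha => hm a (Ideal.pow_le_pow_right (by lia) ha)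
    obtain ⟨y, hy⟩ := ev1_surj I (n + m) x hm'
    refine ⟨n + m, by lia, ?_⟩
    rw [epre_edelta]
    refine (les3 (A := R ⧸ I ^ (n + m)) f' g hf' hfg hg 0 _).2 ⟨y, ?_⟩
    apply ev1_inj I (n + m)
    rw [ev1_tr, ← hx, ← hy, ev1_apply, ev1_apply, e0_epost]
    rfl
  | succ j ih =>
    intro N _ _ hN n e
    obtain ⟨E, _, _, f, hE, hf⟩ := exists_inj R N
    have hmem : ∀ x, f x ∈ Gam I E := fun x => by
      obtain ⟨n, hn⟩ := hN x
      exact ⟨n, fun a ha => by rw [← map_smul, hn a ha, map_zero]⟩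
    let f' : N →ₗ[R] Gam I E := f.codRestrict _ hmem
    have hf' : Function.Injective f' := fun x y h => hf (congrArg Subtype.val h)
    have hQ := Gam_injective I E hE
    let g := (LinearMap.range f').mkQ
    have hg : Function.Surjective g := Submodule.mkQ_surjective _
    have hfg : Function.Exact f' g := LinearMap.exact_map_mkQ_range f'
    have := EE_inj_zero _ hQ (R ⧸ I ^ n) (j+1)
    obtain ⟨e', rfl⟩ := (les1 (A := R ⧸ I ^ n) f' g hf' hfg hg (j+1) e).1 (Subsingleton.elim _ _)
    obtain ⟨m, h, hm⟩ := ih _ ((Tors.Gam (K := E) I).of_surj g hg) n e'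
    refine ⟨m, h, ?_⟩
    rw [epre_edelta, hm, map_zero]

section
variable (f : K →ₗ[R] L) (g : L →ₗ[R] N) (hf : Function.Injective f) (hfg : Function.Exact f g)
  (hg : Function.Surjective g)
include hf hfg hg

/-- killing torsion -/
lemma K1b (hK : Tors I K) (i : ℕ) : Nonempty (HH I (i+1) L ≃ₗ[R] HH I (i+1) N) := by
  let F : HH I (i+1) L →ₗ[R] HH I (i+1) N :=
    dlLift I (fun n => dlof I (i+1) N n ∘ₗ epost (R ⧸ I ^ n) g (i+1))
      (fun n m h e => by
        rw [LinearMap.comp_apply, LinearMap.comp_apply, ← epre_epost, dlof_tr])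
  have hF : ∀ n e, F (dlof I (i+1) L n e) = dlof I (i+1) N n (epost (R ⧸ I ^ n) g (i+1) e) := by
    intro n e
    rw [dlLift_of]; rfl
  refine ⟨LinearEquiv.ofBijective F ⟨?_, ?_⟩⟩
  · rw [← LinearMap.ker_eq_bot, eq_bot_iff]
    intro x hx
    obtain ⟨n, e, rfl⟩ := dl_exists I x
    rw [LinearMap.mem_ker, hF] at hx
    obtain ⟨m, h, hm⟩ := dl_zero I _ hx
    rw [epre_epost] at hm
    obtain ⟨y, hy⟩ := (les2 (A := R ⧸ I ^ m) f g hf hfg hg (i+1) _).1 hm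
    obtain ⟨m', h', hm'⟩ := torsion_vanish I i K hK m y
    rw [Submodule.mem_bot, ← dlof_tr I (h.trans h'), ← epre_tr_tr I h h', ← hy, epre_epost, hm', map_zero,
      map_zero]
  · intro x
    obtain ⟨n, e, rfl⟩ := dl_exists I x
    obtain ⟨m, h, hm⟩ := torsion_vanish I (i+1) K hK n (edelta (R ⧸ I ^ n) f g hf hfg hg (i+1) e)
    rw [epre_edelta] at hm
    obtain ⟨y, hy⟩ := (les3 (A := R ⧸ I ^ m) f g hf hfg hg (i+1) _).1 hm
    refine ⟨dlof I (i+1) L m y, ?_⟩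
    rw [hF, hy, dlof_tr]

end

lemma VE_of_HH (i : ℕ) : ∀ (X : Type u) [AddCommGroup X] [Module R X],
    (∀ j, Subsingleton (HH I j X)) → Subsingleton (EE R (R ⧸ I) X i) := by
  have hTF : ∀ (X : Type u) [AddCommGroup X] [Module R X],
    (∀ j, Subsingleton (HH I j X)) → TF I X := by
    intro X _ _ hX k hk
    obtain ⟨e⟩ := K0 (K := X) I
    have := hX 0
    have h1 : Subsingleton (Gam I X) := e.symm.toEquiv.subsingleton
    exact congrArg Subtype.val (Subsingleton.elim (⟨k, 1, by simpa [mem_an] using hk⟩ : Gam I X) 0)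
  induction i with
  | zero =>
    intro X _ _ hX
    exact TF.iff_sub.1 (hTF X hX)
  | succ i ih =>
    intro X _ _ hX
    obtain ⟨E, _, _, f, hE, hf⟩ := exists_sigma X (hTF X hX)
    have hg : Function.Surjective (LinearMap.range f).mkQ := Submodule.mkQ_surjective _
    have hfg := LinearMap.exact_map_mkQ_range f
    have h1 := ih (E ⧸ LinearMap.range f) (fun j => by
      obtain ⟨e⟩ := K1a I f _ hf hfg hg hE j
      have := hX (j+1)
      exact e.toEquiv.subsingleton)
    have := hE (i+1)
    refine ⟨fun x y => ?_⟩
    obtain ⟨x, rfl⟩ := (les1 (A := R ⧸ I) f _ hf hfg hg i x).1 (Subsingleton.elim _ _)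
    obtain ⟨y, rfl⟩ := (les1 (A := R ⧸ I) f _ hf hfg hg i y).1 (Subsingleton.elim _ _)
    rw [Subsingleton.elim x y]

/-- The key property -/
def PP (I a : Ideal R) : Prop := ∀ (K : Type u) [AddCommGroup K] [Module R K], Tors I K →
  (∀ r ∈ a, ∀ k : K, r • k = 0) → FE (R := R) (R ⧸ I) K 0 → FE (R := R) (R ⧸ I) K 1 → Cof I K

lemma sub_of_sub {A B C : Type*} [AddCommGroup A] [AddCommGroup B] [AddCommGroup C]
    [Module R A] [Module R B] [Module R C] {f : A →ₗ[R] B} {g : B →ₗ[R] C}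
    (h : Function.Exact f g) [Subsingleton A] : Function.Injective g := by
  rw [← LinearMap.ker_eq_bot, eq_bot_iff]
  intro x hx
  obtain ⟨a, rfl⟩ := (h x).1 hx
  rw [Subsingleton.elim a 0, map_zero]; exact Submodule.zero_mem _

lemma HH_cof (hP : PP I ⊥) (i : ℕ) : ∀ (M : Type u) [AddCommGroup M] [Module R M], Cof I M →
    Cof I (HH I i M) := by
  have hG : ∀ (M : Type u) [AddCommGroup M] [Module R M], Cof I M → Cof I (Gam I M) := by
    intro M _ _ hM
    refine hP _ (Tors.Gam I) ?_ ?_ ?_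
    · intro r hr k
      rw [(Submodule.mem_bot R).1 hr, zero_smul]
    · exact FE.left0 (Gam I M).subtype (Submodule.subtype_injective _) (hM 0)
    · have := TF.iff_sub.1 (TF.quot_Gam (K := M) I)
      exact fin_of_inj (sub_of_sub (les1 (A := R ⧸ I) (Gam I M).subtype (Gam I M).mkQ
        (Submodule.subtype_injective _) (exact_mkQ _) (Submodule.mkQ_surjective _) 0)) (hM 1)
  induction i with
  | zero =>
    intro M _ _ hM
    obtain ⟨e⟩ := K0 (K := M) I
    exact (hG M hM).equiv e.symm
  | succ i ih =>
    intro M _ _ hM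
    have hM' : Cof I (M ⧸ Gam I M) := Cof.right (Gam I M).subtype (Gam I M).mkQ
        (Submodule.subtype_injective _) (exact_mkQ _) (Submodule.mkQ_surjective _) (hG M hM) hM
    obtain ⟨e1⟩ := K1b I (Gam I M).subtype (Gam I M).mkQ
        (Submodule.subtype_injective _) (exact_mkQ _) (Submodule.mkQ_surjective _)
        (Tors.Gam I) i
    obtain ⟨E, _, _, f, hE, hf⟩ := exists_sigma _ (TF.quot_Gam (K := M) I)
    have hg : Function.Surjective (LinearMap.range f).mkQ := Submodule.mkQ_surjective _
    have hfg := LinearMap.exact_map_mkQ_range f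
    obtain ⟨e2⟩ := K1a I f _ hf hfg hg hE i
    have hS : Cof I (E ⧸ LinearMap.range f) := by
      intro j
      have := hE j
      exact fin_of_inj (sub_of_sub (les3 (A := R ⧸ I) f _ hf hfg hg j)) (hM' (j+1))
    exact (ih _ hS).equiv (e2.trans e1.symm)

lemma isCofinite_of_PP (hP : PP I ⊥) (M : ModuleCat.{u} R) (hM : Module.Finite R M) (i : ℕ) :
    IsCofinite I ((localCohomology I i).obj M) := by
  have e := lcEquiv I i M
  have hc : Cof I (HH I i M) := HH_cof I hP i M Cof.of_fin
  have ht : Tors I (HH I i M) := HH_tors I i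
  refine ⟨?_, fun j => ?_⟩
  · exact (ht.of_inj (K := (localCohomology I i).obj M) e.symm.toLinearMap e.symm.injective).support
  · have h1 := (hc.equiv (L := (localCohomology I i).obj M) e) j
    unfold FE at h1
    exact Module.Finite.equiv (extEq (ModuleCat.of R (R ⧸ I)) ((localCohomology I i).obj M) j).symm

end DLim

end CofPf

namespace CofPf

section Glue

set_option linter.unusedSectionVars false

variable {R : Type u} [CommRing R] [IsNoetherianRing R] (I : Ideal R)

variable {K L N : Type u} 
  [AddCommGroup K] [Module R K] [AddCommGroup L] [Module R L] [AddCommGroup N] [Module R N]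

lemma PP.mono {I a b : Ideal R} (h : a ≤ b) (ha : PP I a) : PP I b :=
  fun K _ _ hT hk h0 h1 => ha K hT (fun r hr => hk r (h hr)) h0 h1

/-- If K embeds mod `an a K`, finiteness of Hom. -/
lemma FE0_quot_an (a : Ideal R) (h : FE (R := R) (R ⧸ I) K 0) :
    FE (R := R) (R ⧸ I) (K ⧸ an a K) 0 := by
  rw [FE0_iff] at h ⊢
  obtain ⟨s, hs⟩ := (IsNoetherian.noetherian a : a.FG)
  have hker : ∀ r ∈ a, an a K ≤ LinearMap.ker (LinearMap.lsmul R K r) := fun r hr x hx => hx r hr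
  have hsa : ∀ r : s, r.1 ∈ a := fun r => hs ▸ Ideal.subset_span r.2
  let φ : ∀ r : s, (K ⧸ an a K) →ₗ[R] K := fun r =>
    Submodule.liftQ _ (LinearMap.lsmul R K r.1) (hker r.1 (hsa r))
  have hφ : ∀ r : s, ∀ x ∈ an I (K ⧸ an a K), φ r x ∈ an I K := fun r x hx b hb => by
    rw [← map_smul, hx b hb, map_zero]
  let Φ : an I (K ⧸ an a K) →ₗ[R] (s → an I K) := LinearMap.pi (fun r => (φ r).restrict (hφ r))
  refine Module.Finite.of_injective Φ ?_
  rw [← LinearMap.ker_eq_bot, eq_bot_iff]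
  rintro ⟨x, hx⟩ hx0
  obtain ⟨x, rfl⟩ := Submodule.Quotient.mk_surjective _ x
  rw [Submodule.mem_bot]
  ext
  change Submodule.Quotient.mk x = (0 : K ⧸ an a K)
  rw [Submodule.Quotient.mk_eq_zero]
  have h1 : ∀ r : s, r.1 • x = 0 := fun r => congrArg Subtype.val (congrFun hx0 r)
  have h2 : a ≤ LinearMap.ker (LinearMap.toSpanSingleton R K x) := by
    rw [← hs, Submodule.span_le]
    intro r hr
    exact h1 ⟨r, hr⟩
  intro r hr
  exact h2 hr

lemma PP.mul {I a b : Ideal R} (ha : PP I a) (hb : PP I b) : PP I (a * b) := by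
  intro K _ _ hT hk h0 h1
  have hi := Submodule.subtype_injective (an a K)
  have he := exact_mkQ (an a K)
  have hs := Submodule.mkQ_surjective (an a K)
  have hq0 := FE0_quot_an I a h0
  have hK' : Cof I (an a K) := by
    refine ha _ (hT.of_inj _ hi) (fun r hr k => by ext; exact k.2 r hr) (FE.left0 _ hi h0) ?_
    exact FE.left _ _ hi he hs hq0 h1
  have hK'' : Cof I (K ⧸ an a K) := by
    refine hb _ (hT.of_surj _ hs) ?_ hq0 (FE.right _ _ hi he hs h1 (hK' 2))
    intro r hr k
    obtain ⟨k, rfl⟩ := Submodule.Quotient.mk_surjective _ k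
    rw [← Submodule.Quotient.mk_smul, Submodule.Quotient.mk_eq_zero]
    intro t ht
    rw [← mul_smul]
    exact hk _ (Ideal.mul_mem_mul ht hr) k
  exact Cof.mid _ _ hi he hs hK' hK''

lemma PP.top : PP I ⊤ := by
  intro K _ _ hT hk h0 h1
  have : Subsingleton K := ⟨fun x y => by
    rw [← one_smul R x, hk 1 trivial x, ← one_smul R y, hk 1 trivial y]⟩
  exact Cof.of_subsingleton

lemma PP.caseA1 {p : Ideal R} (h : I ≤ p) : PP I p := by
  intro K _ _ hT hk h0 h1
  rw [FE0_iff] at h0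
  have : an I K = ⊤ := by
    rw [eq_top_iff]
    intro x _ a ha
    exact hk a (h ha) x
  rw [this] at h0
  have : Module.Finite R K := Module.Finite.equiv (Submodule.topEquiv (R := R) (M := K))
  exact Cof.of_fin

lemma PP.caseA2 {p : Ideal R} (h : I + p = ⊤) : PP I p := by
  intro K _ _ hT hk h0 h1
  have h2 : ∀ k ∈ an I K, k = 0 := by
    intro k hkk
    have : (1 : R) ∈ I + p := by rw [h]; trivial
    obtain ⟨a, ha, b, hb, hab⟩ := Submodule.mem_sup.1 this
    rw [← one_smul R k, ← hab, add_smul, hkk a ha, hk b hb k, add_zero]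
  have : Subsingleton K := ⟨fun x y => by
    rw [hT.eq_zero_of_an h2 x, hT.eq_zero_of_an h2 y]⟩
  exact Cof.of_subsingleton

lemma PP.of_min (h : ∀ p ∈ minimalAssociatedPrimes R, PP I p) : PP I ⊥ := by
  obtain ⟨Z, hZ⟩ := PrimeSpectrum.exists_primeSpectrum_prod_le R (⊥ : Ideal R)
  refine PP.mono hZ ?_
  clear hZ
  induction Z using Multiset.induction_on with
  | empty => simpa using PP.top I
  | cons q Z ih =>
    rw [Multiset.map_cons, Multiset.prod_cons]
    refine PP.mul ?_ ih
    have := q.2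
    obtain ⟨p, hp, hpq⟩ := Ideal.exists_minimalPrimes_le (I := (⊥ : Ideal R)) (J := q.asIdeal) bot_le
    refine PP.mono hpq (h p ⟨?_, ?_⟩)
    · apply Module.associatedPrimes.minimalPrimes_annihilator_subset_associatedPrimes R R
      convert hp
      rw [Module.annihilator_eq_bot]
      infer_instance
    · intro r hr hrp
      exact le_antisymm hrp (hp.2 ⟨hr.isPrime, bot_le⟩ hrp)

end Glue

end CofPf

namespace CofPf

section WArtSec

set_option linter.unusedSectionVars false

variable {R : Type u} [CommRing R] [IsNoetherianRing R]

variable {K L N : Type u} 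
  [AddCommGroup K] [Module R K] [AddCommGroup L] [Module R L] [AddCommGroup N] [Module R N]

/-- saturation -/
def Wsat (W : Submonoid R) (M : Submodule R K) : Submodule R K where
  carrier := {k | ∃ w ∈ W, w • k ∈ M}
  add_mem' := by
    rintro x y ⟨v, hv, hx⟩ ⟨w, hw, hy⟩
    refine ⟨v * w, W.mul_mem hv hw, ?_⟩
    rw [smul_add]
    refine M.add_mem ?_ ?_
    · rw [mul_comm, mul_smul]; exact M.smul_mem _ hx
    · rw [mul_smul]; exact M.smul_mem _ hy
  zero_mem' := ⟨1, W.one_mem, by simp⟩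
  smul_mem' := by
    rintro r x ⟨w, hw, hx⟩
    refine ⟨w, hw, ?_⟩
    rw [smul_comm]; exact M.smul_mem _ hx

lemma le_Wsat (W : Submonoid R) (M : Submodule R K) : M ≤ Wsat W M :=
  fun x hx => ⟨1, W.one_mem, by simpa using hx⟩

lemma Wsat_mono (W : Submonoid R) {M M' : Submodule R K} (h : M ≤ M') : Wsat W M ≤ Wsat W M' := by
  rintro x ⟨w, hw, hx⟩
  exact ⟨w, hw, h hx⟩

lemma Wsat_sat (W : Submonoid R) (M : Submodule R K) (w : R) (hw : w ∈ W) (k : K)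
    (h : w • k ∈ Wsat W M) : k ∈ Wsat W M := by
  obtain ⟨v, hv, h⟩ := h
  exact ⟨v * w, W.mul_mem hv hw, by rwa [mul_smul]⟩

/-- saturated submodules -/
abbrev SatSub (W : Submonoid R) (K : Type u) [AddCommGroup K] [Module R K] : Type u :=
  {M : Submodule R K // ∀ w ∈ W, ∀ k, w • k ∈ M → k ∈ M}

/-- saturation as a saturated submodule -/
def mkSat (W : Submonoid R) (M : Submodule R K) : SatSub W K := ⟨Wsat W M, Wsat_sat W M⟩

lemma mkSat_mono (W : Submonoid R) {M M' : Submodule R K} (h : M ≤ M') : mkSat W M ≤ mkSat W M' :=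
  Wsat_mono W h

lemma mem_of_mkSat {W : Submonoid R} {M M' : Submodule R K} (h : mkSat W M' = mkSat W M) {x : K}
    (hx : x ∈ M) : ∃ w ∈ W, w • x ∈ M' := by
  have : x ∈ (mkSat W M).1 := le_Wsat W M hx
  rw [← h] at this
  exact this

/-- W-Artinian -/
def WArt (W : Submonoid R) (K : Type u) [AddCommGroup K] [Module R K] : Prop :=
  WellFoundedLT (SatSub W K)

lemma WArt.of_map {W : Submonoid R} {α : Type*} [PartialOrder α] [WellFoundedLT α]
    (φ : SatSub W K → α) (hm : Monotone φ)
    (h : ∀ M M' : SatSub W K, M' ≤ M → φ M' = φ M → ∀ x ∈ M.1, x ∈ M'.1) : WArt W K := by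
  have : StrictMono φ := by
    intro M' M hlt
    refine lt_of_le_of_ne (hm hlt.le) ?_
    intro he
    exact hlt.not_ge (h M M' hlt.le he)
  exact this.wellFoundedLT

lemma WArt.of_inj {W : Submonoid R} (f : K →ₗ[R] L) (hf : Function.Injective f) (h : WArt W L) :
    WArt W K := by
  have : WellFoundedLT (SatSub W L) := h
  refine WArt.of_map (fun M => mkSat W (M.1.map f))
    (fun M M' hle => mkSat_mono W (Submodule.map_mono hle)) ?_
  intro M M' hle he x hx
  obtain ⟨w, hw, y, hy, hyx⟩ := mem_of_mkSat he (Submodule.mem_map_of_mem hx)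
  rw [← map_smul] at hyx
  have := hf hyx
  exact M'.2 w hw x (this ▸ hy)

lemma WArt.of_exact {W : Submonoid R} (f : K →ₗ[R] L) (g : L →ₗ[R] N)
    (hfg : Function.Exact f g) (hK : WArt W K) (hN : WArt W N) : WArt W L := by
  have : WellFoundedLT (SatSub W K) := hK
  have : WellFoundedLT (SatSub W N) := hN
  refine WArt.of_map (fun M => ((mkSat W (M.1.comap f), mkSat W (M.1.map g)) : SatSub W K × SatSub W N))
    (fun M M' hle => Prod.mk_le_mk.2 ⟨mkSat_mono W (Submodule.comap_mono hle), mkSat_mono W (Submodule.map_mono hle)⟩) ?_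
  intro M M' hle he x hx
  obtain ⟨h1, h2⟩ := Prod.mk.inj he
  obtain ⟨w, hw, y, hy, hyx⟩ := mem_of_mkSat h2 (Submodule.mem_map_of_mem hx)
  rw [← map_smul, ← sub_eq_zero, ← map_sub] at hyx
  obtain ⟨z, hz⟩ := (hfg _).1 hyx
  have hzM : z ∈ M.1.comap f := by
    rw [Submodule.mem_comap, hz]
    exact M.1.sub_mem (hle hy) (M.1.smul_mem _ hx)
  obtain ⟨v, hv, hvz⟩ := mem_of_mkSat h1 hzM
  rw [Submodule.mem_comap, map_smul] at hvz
  have := M'.2 v hv _ hvz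
  rw [hz] at this
  refine M'.2 w hw x ?_
  have h3 := M'.1.sub_mem hy this
  simpa using h3

lemma WArt.of_simple {W : Submonoid R} (h : ∀ M : SatSub W K, M.1 = ⊥ ∨ M.1 = ⊤) : WArt W K := by
  have : Finite (SatSub W K) := by
    refine Finite.of_injective (fun M : SatSub W K => M.1 = ⊤) ?_
    intro M M' he
    have he : (M.1 = ⊤) = (M'.1 = ⊤) := he
    apply Subtype.ext
    rcases h M with h1 | h1 <;> rcases h M' with h2 | h2
    · rw [h1, h2]
    · rw [h2, he.mpr h2]
    · rw [h1, he.mp h1]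
    · rw [h1, h2]
  exact Finite.to_wellFoundedLT

/-- kernel of multiplication -/
abbrev kx (x : R) (K : Type u) [AddCommGroup K] [Module R K] : Submodule R K :=
  LinearMap.ker (LinearMap.lsmul R K x)

lemma mem_kx {x : R} {k : K} : k ∈ kx x K ↔ x • k = 0 := Iff.rfl

/-- one element lemma -/
lemma WArt.one_elt {W : Submonoid R} (x : R) (hx : ∀ k : K, ∃ n : ℕ, x ^ n • k = 0)
    (h : WArt W (kx x K)) : WArt W K := by
  have hwf : WellFoundedLT (SatSub W (kx x K)) := h
  let A : SatSub W K → ℕ → SatSub W (kx x K) := fun M n =>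
    mkSat W ((M.1.map (LinearMap.lsmul R K (x ^ n))).comap (kx x K).subtype)
  have hA : ∀ M M' n n', M ≤ M' → n' ≤ n → A M n ≤ A M' n' := by
    intro M M' n n' h1 h2
    apply mkSat_mono
    apply Submodule.comap_mono
    rintro _ ⟨y, hy, rfl⟩
    refine ⟨x ^ (n - n') • y, M'.1.smul_mem _ (h1 hy), ?_⟩
    simp only [LinearMap.lsmul_apply]
    rw [← mul_smul, ← pow_add]
    congr 2; lia
  have key : ∀ M M' : SatSub W K, M' ≤ M → (∀ n, A M' n = A M n) → M = M' := by
    intro M M' hle he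
    refine le_antisymm ?_ hle
    suffices hs : ∀ n, ∀ y ∈ M.1, x ^ n • y = 0 → y ∈ M'.1 by
      intro y hy
      obtain ⟨n, hn⟩ := hx y
      exact hs n y hy hn
    intro n
    induction n with
    | zero => intro y hy h0; rw [pow_zero, one_smul] at h0; rw [h0]; exact M'.1.zero_mem
    | succ n ih =>
      intro y hy h0
      have hmem : (⟨x ^ n • y, by rw [mem_kx, ← mul_smul, ← pow_succ', h0]⟩ : kx x K) ∈
          (M.1.map (LinearMap.lsmul R K (x ^ n))).comap (kx x K).subtype := ⟨y, hy, rfl⟩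
      obtain ⟨w, hw, y', hy', hyy⟩ := mem_of_mkSat (he n) hmem
      have hyy : x ^ n • y' = w • (x ^ n • y) := hyy
      have h1 : w • y - y' ∈ M'.1 := by
        apply ih _ (M.1.sub_mem (M.1.smul_mem _ hy) (hle hy'))
        rw [smul_sub, hyy, smul_comm, sub_self]
      refine M'.2 w hw y ?_
      have := M'.1.add_mem h1 hy'
      simpa using this
  change WellFoundedLT (SatSub W K)
  have stab : ∀ c : ℕ → SatSub W (kx x K), Antitone c → ∃ n, ∀ m, n ≤ m → c n = c m := by
    intro c hc
    exact (wellFoundedGT_iff_monotone_chain_condition (α := (SatSub W (kx x K))ᵒᵈ)).1 inferInstance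
      ⟨fun n => OrderDual.toDual (c n), fun a b hab => hc hab⟩
  suffices hs : WellFoundedGT (SatSub W K)ᵒᵈ by
    exact ⟨hs.wf⟩
  rw [wellFoundedGT_iff_monotone_chain_condition]
  intro a
  have ha : ∀ m m', m ≤ m' → OrderDual.ofDual (a m') ≤ OrderDual.ofDual (a m) :=
    fun m m' h => a.monotone h
  obtain ⟨m0, hm0⟩ := stab (fun m => A (OrderDual.ofDual (a m)) m)
    (fun m m' h => hA _ _ _ _ (ha _ _ h) h)
  have h2 := fun n => stab (fun m => A (OrderDual.ofDual (a m)) n)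
    (fun m m' h => hA _ _ _ _ (ha _ _ h) le_rfl)
  choose M hM using h2
  let M1 := m0 + ∑ n ∈ Finset.range m0, M n
  refine ⟨M1, fun m hm => ?_⟩
  have hconst : ∀ m n, m0 ≤ m → m0 ≤ n → A (OrderDual.ofDual (a m)) n =
      A (OrderDual.ofDual (a m0)) m0 := by
    intro m n h1 h2
    refine le_antisymm (hA _ _ _ _ (ha _ _ h1) h2) ?_
    have h3 := hm0 (max m n) (by lia)
    rw [h3]
    exact hA _ _ _ _ (ha _ _ (le_max_left _ _)) (le_max_right _ _)
  refine congrArg OrderDual.toDual (key (OrderDual.ofDual (a M1)) (OrderDual.ofDual (a m)) (ha _ _ hm) ?_)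
  intro n
  by_cases hn : m0 ≤ n
  · rw [hconst m n (by lia) hn, hconst M1 n (by lia) hn]
  · have hle : M n ≤ ∑ n ∈ Finset.range m0, M n :=
      Finset.single_le_sum (f := M) (fun _ _ => Nat.zero_le _) (Finset.mem_range.2 (by lia))
    have h3 := hM n m (by lia)
    have h4 := hM n M1 (by lia)
    rw [← h3, ← h4]

lemma WArt.of_an {W : Submonoid R} {I : Ideal R} (hT : Tors I K) (h : WArt W (an I K)) :
    WArt W K := by
  classical
  obtain ⟨s, rfl⟩ := (IsNoetherian.noetherian I : I.FG)
  have hT' : ∀ x ∈ s, ∀ k : K, ∃ n : ℕ, x ^ n • k = 0 := by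
    intro x hx k
    obtain ⟨n, hn⟩ := hT k
    exact ⟨n, hn _ (Ideal.pow_mem_pow (Ideal.subset_span hx) n)⟩
  clear hT
  induction s using Finset.induction_on generalizing K with
  | empty =>
    refine WArt.of_inj (LinearMap.codRestrict (an _ K) LinearMap.id ?_) ?_ h
    · intro k a ha
      have : a = 0 := by simpa using ha
      rw [this, zero_smul]
    · intro x y hxy
      exact congrArg Subtype.val hxy
  | insert x s hxs ih =>
    apply WArt.one_elt x (hT' x (by simp))
    apply ih
    · refine WArt.of_inj (LinearMap.codRestrict (an _ K)
        ((kx x K).subtype ∘ₗ (an (Ideal.span (s : Set R)) (kx x K)).subtype) ?_) ?_ h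
      · rintro ⟨⟨k, hk⟩, hk'⟩
        have h1 : Ideal.span ((insert x s : Finset R) : Set R) ≤
            LinearMap.ker (LinearMap.toSpanSingleton R K k) := by
          refine Ideal.span_le.2 ?_
          intro a ha
          rcases Finset.mem_insert.1 ha with rfl | ha
          · exact hk
          · exact congrArg Subtype.val (hk' a (Ideal.subset_span ha))
        intro a ha
        exact h1 ha
      · intro x y hxy
        apply Subtype.ext; apply Subtype.ext
        have h5 := congrArg Subtype.val hxy
        exact h5
    · intro y hy k
      obtain ⟨n, hn⟩ := hT' y (by simp [hy]) k.1
      exact ⟨n, by ext; exact hn⟩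

end WArtSec

end CofPf

namespace CofPf

section CaseD

set_option linter.unusedSectionVars false

variable {R : Type u} [CommRing R] [IsNoetherianRing R]

variable {K L N : Type u} 
  [AddCommGroup K] [Module R K] [AddCommGroup L] [Module R L] [AddCommGroup N] [Module R N]

lemma Cof.of_epost_zero (I : Ideal R) (f : K →ₗ[R] L) (h1 : Cof I (LinearMap.ker f))
    (h2 : Cof I (L ⧸ LinearMap.range f)) (h0 : ∀ i, epost (R ⧸ I) f i = 0) : Cof I K := by
  intro i
  have hr : Module.Finite R (LinearMap.range (epost (R ⧸ I) f.rangeRestrict i)) := by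
    cases i with
    | zero =>
      have : epost (R ⧸ I) f.rangeRestrict 0 = 0 := by
        ext e
        apply epost_inj0 (LinearMap.range f).subtype (Submodule.injective_subtype _)
        rw [← epost_comp]
        have := LinearMap.congr_fun (h0 0) e
        simpa using this
      rw [this, LinearMap.range_zero]
      infer_instance
    | succ i =>
      have hle : LinearMap.range (epost (R ⧸ I) f.rangeRestrict (i+1)) ≤
          LinearMap.range (edelta (R ⧸ I) (LinearMap.range f).subtype (LinearMap.range f).mkQ
            (Submodule.injective_subtype _) (exact_mkQ _) (Submodule.mkQ_surjective _) i) := by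
        rintro _ ⟨e, rfl⟩
        apply (les1 (A := R ⧸ I) (LinearMap.range f).subtype (LinearMap.range f).mkQ
            (Submodule.injective_subtype _) (exact_mkQ _) (Submodule.mkQ_surjective _) i _).1
        rw [← epost_comp]
        have := LinearMap.congr_fun (h0 (i+1)) e
        simpa using this
      have h3 : Module.Finite R (EE R (R ⧸ I) (L ⧸ LinearMap.range f) i) := h2 i
      exact fin_of_inj (Submodule.inclusion_injective hle) inferInstance
  have hex : Function.Exact (epost (R ⧸ I) (LinearMap.ker f).subtype i)
      (epost (R ⧸ I) f.rangeRestrict i).rangeRestrict := by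
    have := les2 (A := R ⧸ I) (LinearMap.ker f).subtype f.rangeRestrict
      (Submodule.injective_subtype _)
      (by intro x; rw [← LinearMap.mem_ker, LinearMap.ker_rangeRestrict]; simp)
      (LinearMap.surjective_rangeRestrict f) i
    intro x
    rw [← this x]
    exact Subtype.ext_iff
  exact fin_of_exact hex (h1 i) hr

/-- W-zero modules -/
def WZ (W : Submonoid R) (N : Type u) [AddCommGroup N] [Module R N] : Prop :=
  ∀ n : N, ∃ w ∈ W, w • n = 0

lemma WZ.ideal {W : Submonoid R} {I : Ideal R} (y : L) (h : ∀ x ∈ I, ∃ w ∈ W, x • (w • y) = 0) :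
    ∃ w ∈ W, w • y ∈ an I L := by
  classical
  obtain ⟨s, rfl⟩ := (IsNoetherian.noetherian I : I.FG)
  have h : ∀ x ∈ s, ∃ w ∈ W, x • (w • y) = 0 := fun x hx => h x (Ideal.subset_span hx)
  have : ∃ w ∈ W, ∀ x ∈ s, x • (w • y) = 0 := by
    choose! w hw h using h
    refine ⟨∏ x ∈ s, w x, W.prod_mem hw, ?_⟩
    intro x hx
    rw [← Finset.mul_prod_erase s w hx, mul_comm, mul_smul, smul_comm, h x hx, smul_zero]
  obtain ⟨w, hw, hx⟩ := this
  refine ⟨w, hw, ?_⟩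
  have h1 : Ideal.span (s : Set R) ≤ LinearMap.ker (LinearMap.toSpanSingleton R L (w • y)) :=
    Ideal.span_le.2 fun a ha => hx a ha
  intro a ha
  exact h1 ha

lemma main_D (W : Submonoid R) (C : Prop) (I p : Ideal R)
    (H : ∀ (N : Type u) [AddCommGroup N] [Module R N], Tors I N → (∀ r ∈ p, ∀ k : N, r • k = 0) →
      WZ W N → (C → FE (R := R) (R ⧸ I) N 0) → Cof I N)
    (hT : Tors I K) (hp : ∀ r ∈ p, ∀ k : K, r • k = 0) (hW : WArt W K)
    (h0 : FE (R := R) (R ⧸ I) K 0) (h1 : C → FE (R := R) (R ⧸ I) K 1) : Cof I K := by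
  have hwf : WellFoundedLT (SatSub W K) := hW
  suffices hs : ∀ s : SatSub W K, ∀ (L : Type u) [AddCommGroup L] [Module R L] (j : L →ₗ[R] K),
      Function.Injective j → mkSat W (LinearMap.range j) = s → (C → FE (R := R) (R ⧸ I) L 1) →
        Cof I L from hs _ K LinearMap.id (fun x y h => h) rfl h1
  intro s
  induction s using hwf.wf.induction with
  | _ s ih =>
  intro L _ _ j hj hjs hL1
  have hLT : Tors I L := Tors.of_inj j hj hT
  have hLp : ∀ r ∈ p, ∀ k : L, r • k = 0 := fun r hr k => hj (by rw [map_smul, hp r hr, map_zero])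
  have hL0 : FE (R := R) (R ⧸ I) L 0 := FE.left0 j hj h0
  have sub : ∀ (U : Submodule R L), mkSat W (LinearMap.range (j ∘ₗ U.subtype)) ≤ s := by
    intro U
    rw [← hjs]
    exact mkSat_mono W (LinearMap.range_comp_le_range _ _)
  have wz : ∀ (U : Submodule R L), mkSat W (LinearMap.range (j ∘ₗ U.subtype)) = s →
      ∀ y : L, ∃ w ∈ W, w • y ∈ U := by
    intro U hU y
    obtain ⟨w, hw, z, hz⟩ := mem_of_mkSat (hU.trans hjs.symm) (LinearMap.mem_range_self j y)
    refine ⟨w, hw, ?_⟩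
    rw [← map_smul] at hz
    rw [← hj hz]
    exact z.2
  have ihU : ∀ (U : Submodule R L), mkSat W (LinearMap.range (j ∘ₗ U.subtype)) ≠ s →
      (C → FE (R := R) (R ⧸ I) U 1) → Cof I U := by
    intro U hU h
    exact ih _ (lt_of_le_of_ne (sub U) hU) U (j ∘ₗ U.subtype)
      (hj.comp (Submodule.injective_subtype U)) rfl h
  by_cases hcase : ∀ x ∈ I, mkSat W (LinearMap.range (j ∘ₗ (kx x L).subtype)) = s
  · have hfin : Module.Finite R (an I L) := FE0_iff.1 hL0
    refine Cof.mid (an I L).subtype (an I L).mkQ (Submodule.injective_subtype _) (exact_mkQ _)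
      (Submodule.mkQ_surjective _) Cof.of_fin (H _ (Tors.of_surj _ (Submodule.mkQ_surjective _) hLT) ?_ ?_ ?_)
    · intro r hr k
      obtain ⟨k, rfl⟩ := Submodule.mkQ_surjective _ k
      rw [← map_smul, hLp r hr, map_zero]
    · intro k
      obtain ⟨k, rfl⟩ := Submodule.mkQ_surjective _ k
      obtain ⟨w, hw, h⟩ := WZ.ideal (W := W) (I := I) k (fun x hx => by
        obtain ⟨w, hw, h⟩ := wz _ (hcase x hx) k
        exact ⟨w, hw, h⟩)
      refine ⟨w, hw, ?_⟩
      rw [← map_smul]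
      exact (Submodule.Quotient.mk_eq_zero _).2 h
    · intro _
      exact FE0_quot_an I I hL0
  · push Not at hcase
    obtain ⟨x, hx, hne⟩ := hcase
    let f : L →ₗ[R] L := LinearMap.lsmul R L x
    have exf : Function.Exact (LinearMap.ker f).subtype f.rangeRestrict := by
      intro x; rw [← LinearMap.mem_ker, LinearMap.ker_rangeRestrict]; simp
    have hr0 : FE (R := R) (R ⧸ I) (LinearMap.range f) 0 :=
      FE.left0 _ (Submodule.injective_subtype _) hL0
    have hk : Cof I (LinearMap.ker f) := by
      refine ihU _ hne ?_
      intro hC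
      exact FE.left _ _ (Submodule.injective_subtype _) exf (LinearMap.surjective_rangeRestrict f)
        hr0 (hL1 hC)
    have hr1 : C → FE (R := R) (R ⧸ I) (LinearMap.range f) 1 := fun hC =>
      FE.right _ _ (Submodule.injective_subtype _) exf (LinearMap.surjective_rangeRestrict f)
        (hL1 hC) (hk 2)
    by_cases hne2 : mkSat W (LinearMap.range (j ∘ₗ (LinearMap.range f).subtype)) = s
    · refine Cof.of_epost_zero I f hk (H _ (Tors.of_surj _ (Submodule.mkQ_surjective _) hLT) ?_ ?_ ?_) ?_
      · intro r hr k
        obtain ⟨k, rfl⟩ := Submodule.mkQ_surjective _ k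
        rw [← map_smul, hLp r hr, map_zero]
      · intro k
        obtain ⟨k, rfl⟩ := Submodule.mkQ_surjective _ k
        obtain ⟨w, hw, h⟩ := wz _ hne2 k
        refine ⟨w, hw, ?_⟩
        rw [← map_smul]
        exact (Submodule.Quotient.mk_eq_zero _).2 h
      · intro hC
        exact FE.right _ _ (Submodule.injective_subtype _) (exact_mkQ _)
          (Submodule.mkQ_surjective _) hL0 (hr1 hC)
      · intro i
        have hf : f = x • LinearMap.id := by ext; rfl
        ext e
        rw [hf, epost_smul, LinearMap.smul_apply, epost_id]
        refine smul_EE x ?_ i e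
        intro a
        obtain ⟨a, rfl⟩ := Ideal.Quotient.mk_surjective a
        rw [← Ideal.Quotient.mk_eq_mk, ← Submodule.Quotient.mk_smul]
        exact (Submodule.Quotient.mk_eq_zero I).2 (I.mul_mem_right a hx)
    · exact Cof.mid _ _ (Submodule.injective_subtype _) exf (LinearMap.surjective_rangeRestrict f)
        hk (ihU _ hne2 hr1)

lemma art_cof (I : Ideal R) (hT : Tors I K) (hW : WArt (⊥ : Submonoid R) K)
    (h0 : FE (R := R) (R ⧸ I) K 0) : Cof I K := by
  refine main_D ⊥ False I ⊥ ?_ hT ?_ hW h0 False.elim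
  · intro N _ _ _ _ hZ _
    have : Subsingleton N := by
      refine subsingleton_of_forall_eq 0 ?_
      intro n
      obtain ⟨w, hw, h⟩ := hZ n
      rw [Submonoid.mem_bot.1 hw, one_smul] at h
      exact h
    exact Cof.of_subsingleton
  · intro r hr k
    rw [(Submodule.mem_bot R).1 hr, zero_smul]

/-- the multiplicative set avoiding non-maximal minimal primes -/
def WJ (J : Ideal R) : Submonoid R where
  carrier := {w | ∀ q ∈ J.minimalPrimes, ¬ q.IsMaximal → w ∉ q}
  one_mem' := fun q hq _ h => hq.1.1.ne_top ((Ideal.eq_top_iff_one _).2 h)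
  mul_mem' := by
    intro a b ha hb q hq hm h
    rcases hq.1.1.mem_or_mem h with h | h
    · exact ha q hq hm h
    · exact hb q hq hm h

lemma min_of_not_max {J q : Ideal R} (hJ : ringKrullDim (R ⧸ J) ≤ 1) (hq : q.IsPrime) (hle : J ≤ q)
    (hm : ¬ q.IsMaximal) : q ∈ J.minimalPrimes := by
  have h1 : Ring.KrullDimLE 1 (R ⧸ J) := (Order.krullDimLE_iff _ _).2 hJ
  rw [Ring.krullDimLE_one_iff] at h1
  have hker : RingHom.ker (Ideal.Quotient.mk J) ≤ q := by rwa [Ideal.mk_ker]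
  have hp : (q.map (Ideal.Quotient.mk J)).IsPrime :=
    Ideal.map_isPrime_of_surjective Ideal.Quotient.mk_surjective hker
  have hc : (q.map (Ideal.Quotient.mk J)).comap (Ideal.Quotient.mk J) = q := by
    rw [Ideal.comap_map_of_surjective _ Ideal.Quotient.mk_surjective]
    exact sup_eq_left.2 hker
  rcases h1 _ hp with h | h
  · rw [Ideal.minimalPrimes_eq_comap]
    exact ⟨_, h, hc⟩
  · exact absurd (hc ▸ Ideal.comap_isMaximal_of_surjective _ Ideal.Quotient.mk_surjective) hm

lemma WArt.of_ideals {W : Submonoid R} {q : Ideal R} (e : N ≃ₗ[R] R ⧸ q)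
    (h : ∀ a : Ideal R, q < a → ∃ w ∈ W, w ∈ a) : WArt W N := by
  refine WArt.of_inj e.toLinearMap e.injective (WArt.of_simple ?_)
  rintro ⟨M, hM⟩
  by_cases hb : M = ⊥
  · exact Or.inl hb
  right
  obtain ⟨m, hm, hm0⟩ := Submodule.exists_mem_ne_zero_of_ne_bot hb
  have hqa : q < (M.comap q.mkQ : Ideal R) := by
    refine lt_of_le_of_ne ?_ ?_
    · intro x hx
      have : q.mkQ x = 0 := (Submodule.Quotient.mk_eq_zero _).2 hx
      rw [Submodule.mem_comap, this]
      exact M.zero_mem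
    · intro he
      obtain ⟨r, rfl⟩ := q.mkQ_surjective m
      apply hm0
      refine (Submodule.Quotient.mk_eq_zero _).2 ?_
      rw [he]
      exact hm
  obtain ⟨w, hw, hwa⟩ := h _ hqa
  have h1 : q.mkQ 1 ∈ M := by
    apply hM w hw
    rw [← map_smul, smul_eq_mul, mul_one]
    exact hwa
  rw [eq_top_iff]
  intro x _
  obtain ⟨r, rfl⟩ := q.mkQ_surjective x
  have := M.smul_mem r h1
  rwa [← map_smul, smul_eq_mul, mul_one] at this

lemma mem_of_equiv {q : Ideal R} (e : N ≃ₗ[R] R ⧸ q) {r : R} (h : r • (e.symm (q.mkQ 1)) = 0) :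
    r ∈ q := by
  rw [← map_smul, ← map_smul, LinearEquiv.map_eq_zero_iff, smul_eq_mul, mul_one] at h
  exact (Submodule.Quotient.mk_eq_zero _).1 h

lemma WArt.of_J {J : Ideal R} (hJ : ringKrullDim (R ⧸ J) ≤ 1) (X : Type u) [AddCommGroup X]
    [Module R X] (hfin : Module.Finite R X) (hX : ∀ r ∈ J, ∀ k : X, r • k = 0) : WArt (WJ J) X := by
  revert hX
  refine IsNoetherianRing.induction_on_isQuotientEquivQuotientPrime R hfin
    (motive := fun N _ _ _ => (∀ r ∈ J, ∀ k : N, r • k = 0) → WArt (WJ J) N) ?_ ?_ ?_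
  · intro N _ _ _ _ _
    exact WArt.of_simple fun M => Or.inl (Subsingleton.elim _ _)
  · intro N _ _ _ q e hN
    have hq := q.2
    have hle : J ≤ q.1 := fun r hr => mem_of_equiv e (hN r hr _)
    apply WArt.of_ideals e
    intro a ha
    by_cases hm : q.1.IsMaximal
    · rw [hm.1.2 _ ha]
      exact ⟨1, (WJ J).one_mem, trivial⟩
    · have hmin := min_of_not_max hJ hq hle hm
      by_contra! hcon
      have hsub : (a : Set R) ⊆ ⋃ i ∈ {q ∈ J.minimalPrimes | ¬ q.IsMaximal}, (i : Set R) := by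
        intro w hw
        have h1 : ¬ (w ∈ WJ J) := fun h => hcon w h hw
        have h2 : ¬ (∀ q ∈ J.minimalPrimes, ¬ q.IsMaximal → w ∉ q) := h1
        push Not at h2
        obtain ⟨q', h3, h4, h5⟩ := h2
        exact Set.mem_biUnion (x := q') ⟨h3, h4⟩ h5
      have hf : {q ∈ J.minimalPrimes | ¬ q.IsMaximal}.Finite :=
        (Ideal.finite_minimalPrimes_of_isNoetherianRing R J).subset (fun _ h => h.1)
      rw [Ideal.subset_union_prime_finite hf ⊤ ⊤ (fun i hi _ _ => hi.1.1.1)] at hsub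
      obtain ⟨q', h3, h4⟩ := hsub
      exact (ha.trans_le h4).not_ge (h3.1.2 ⟨hq, hle⟩ (ha.le.trans h4))
  · intro N1 _ _ _ N2 _ _ _ N3 _ _ _ f g hf hg hfg h1 h3 hX
    refine WArt.of_exact f g hfg (h1 ?_) (h3 ?_)
    · intro r hr k
      exact hf (by rw [map_smul, hX r hr, map_zero])
    · intro r hr k
      obtain ⟨k, rfl⟩ := hg k
      rw [← map_smul, hX r hr, map_zero]

lemma WArt.of_JZ {J : Ideal R} (hJ : ringKrullDim (R ⧸ J) ≤ 1) (X : Type u) [AddCommGroup X]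
    [Module R X] (hfin : Module.Finite R X) (hX : ∀ r ∈ J, ∀ k : X, r • k = 0)
    (hZ : WZ (WJ J) X) : WArt (⊥ : Submonoid R) X := by
  revert hX hZ
  refine IsNoetherianRing.induction_on_isQuotientEquivQuotientPrime R hfin
    (motive := fun N _ _ _ => (∀ r ∈ J, ∀ k : N, r • k = 0) → WZ (WJ J) N →
      WArt (⊥ : Submonoid R) N) ?_ ?_ ?_
  · intro N _ _ _ _ _ _
    exact WArt.of_simple fun M => Or.inl (Subsingleton.elim _ _)
  · intro N _ _ _ q e hN hZ
    have hq := q.2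
    have hle : J ≤ q.1 := fun r hr => mem_of_equiv e (hN r hr _)
    apply WArt.of_ideals e
    intro a ha
    by_cases hm : q.1.IsMaximal
    · rw [hm.1.2 _ ha]
      exact ⟨1, Submonoid.one_mem _, trivial⟩
    · have hmin := min_of_not_max hJ hq hle hm
      obtain ⟨w, hw, h⟩ := hZ (e.symm (q.1.mkQ 1))
      exact absurd (mem_of_equiv e h) (hw _ hmin hm)
  · intro N1 _ _ _ N2 _ _ _ N3 _ _ _ f g hf hg hfg h1 h3 hX hZ
    refine WArt.of_exact f g hfg (h1 ?_ ?_) (h3 ?_ ?_)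
    · intro r hr k
      exact hf (by rw [map_smul, hX r hr, map_zero])
    · intro k
      obtain ⟨w, hw, h⟩ := hZ (f k)
      exact ⟨w, hw, hf (by rw [map_smul, h, map_zero])⟩
    · intro r hr k
      obtain ⟨k, rfl⟩ := hg k
      rw [← map_smul, hX r hr, map_zero]
    · intro k
      obtain ⟨k, rfl⟩ := hg k
      obtain ⟨w, hw, h⟩ := hZ k
      exact ⟨w, hw, by rw [← map_smul, h, map_zero]⟩

lemma an_killed {I p : Ideal R} (hp : ∀ r ∈ p, ∀ k : K, r • k = 0) :
    ∀ r ∈ I + p, ∀ k : an I K, r • k = 0 := by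
  intro r hr k
  obtain ⟨a, ha, b, hb, rfl⟩ := Submodule.mem_sup.1 hr
  ext
  change (a + b) • (k : K) = 0
  rw [add_smul, k.2 a ha, hp b hb, add_zero]

lemma PP.caseD {I p : Ideal R} (hJ : ringKrullDim (R ⧸ (I + p)) ≤ 1) : PP I p := by
  intro K _ _ hT hp h0 h1
  refine main_D (WJ (I + p)) True I p ?_ hT hp ?_ h0 (fun _ => h1)
  · intro N _ _ hTN hpN hZ hN0
    have hN0 := hN0 trivial
    refine art_cof I hTN (WArt.of_an hTN ?_) hN0
    refine WArt.of_JZ hJ _ (FE0_iff.1 hN0) (an_killed hpN) ?_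
    intro n
    obtain ⟨w, hw, h⟩ := hZ n.1
    exact ⟨w, hw, Subtype.ext h⟩
  · exact WArt.of_an hT (WArt.of_J hJ _ (FE0_iff.1 h0) (an_killed hp))

end CaseD

end CofPf

namespace CofPf

section Kosz

set_option linter.unusedSectionVars false

variable {R : Type u} [CommRing R] [IsNoetherianRing R]

variable {K L N : Type u} 
  [AddCommGroup K] [Module R K] [AddCommGroup L] [Module R L] [AddCommGroup N] [Module R N]

lemma sub_mid {A B C : Type*} [AddCommGroup A] [AddCommGroup B] [AddCommGroup C]
    [Module R A] [Module R B] [Module R C] {f : A →ₗ[R] B} {g : B →ₗ[R] C}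
    (h : Function.Exact f g) (hA : Subsingleton A) (hC : Subsingleton C) : Subsingleton B := by
  refine subsingleton_of_forall_eq 0 fun x => ?_
  exact sub_of_sub h (Subsingleton.elim _ _)

lemma VE.mid {I : Ideal R} (f : K →ₗ[R] L) (g : L →ₗ[R] N) (hf : Function.Injective f)
    (hfg : Function.Exact f g) (hg : Function.Surjective g) (h1 : VE I K) (h2 : VE I N) : VE I L :=
  fun i => sub_mid (les2 (A := R ⧸ I) f g hf hfg hg i) (h1 i) (h2 i)

lemma VE.right {I : Ideal R} (f : K →ₗ[R] L) (g : L →ₗ[R] N) (hf : Function.Injective f)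
    (hfg : Function.Exact f g) (hg : Function.Surjective g) (h1 : VE I K) (h2 : VE I L) : VE I N :=
  fun i => sub_mid (les3 (A := R ⧸ I) f g hf hfg hg i) (h2 i) (h1 (i+1))

lemma VE.left {I : Ideal R} (f : K →ₗ[R] L) (g : L →ₗ[R] N) (hf : Function.Injective f)
    (hfg : Function.Exact f g) (hg : Function.Surjective g) (h1 : VE I L) (h2 : VE I N) : VE I K := by
  intro i
  cases i with
  | zero =>
    have := h1 0
    exact (epost_inj0 (A := R ⧸ I) f hf).subsingleton
  | succ i => exact sub_mid (les1 (A := R ⧸ I) f g hf hfg hg i) (h2 i) (h1 (i+1))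

lemma VE.of_sub (I : Ideal R) [Subsingleton K] : VE I K := by
  intro i
  refine subsingleton_of_forall_eq 0 fun e => ?_
  have := smul_EE' (1 : R) (fun a : K => Subsingleton.elim _ _) i e
  rwa [one_smul] at this

lemma VE.prod {I : Ideal R} (h1 : VE I K) (h2 : VE I L) : VE I (K × L) :=
  VE.mid (LinearMap.inl R K L) (LinearMap.snd R K L) LinearMap.inl_injective
    (by rw [LinearMap.exact_iff, LinearMap.range_inl]) LinearMap.snd_surjective h1 h2

/-- data of a Koszul-like complex -/
structure Kos (I : Ideal R) (T : Type u) [AddCommGroup T] [Module R T] (s : Set R) where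
  Y : ℕ → ModuleCat.{u} R
  d : ∀ k, Y (k+1) →ₗ[R] Y k
  ve : ∀ k, VE I (Y k)
  m : ℕ
  sub : ∀ k, m ≤ k → Subsingleton (Y k)
  dd : ∀ k y, d k (d (k+1) y) = 0
  π : Y 0 →ₗ[R] T
  surj : Function.Surjective π
  πd : ∀ y, π (d 0 y) ∈ (Ideal.span s • ⊤ : Submodule R T)
  htpy : ∀ b ∈ s, ∃ h : ∀ k, Y k →ₗ[R] Y (k+1), (∀ y, d 0 (h 0 y) = b • y) ∧
    ∀ k y, d (k+1) (h (k+1) y) + h k (d k y) = b • y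

/-- base -/
def Kos.base (I : Ideal R) (T : Type u) [AddCommGroup T] [Module R T] (hT : VE I T) :
    Kos I T (∅ : Set R) where
  Y k := match k with
    | 0 => ModuleCat.of R T
    | _ + 1 => ModuleCat.of R PUnit
  d k := 0
  ve k := match k with
    | 0 => hT
    | _ + 1 => VE.of_sub (K := PUnit) I
  m := 1
  sub k hk := match k, hk with
    | _ + 1, _ => inferInstanceAs (Subsingleton PUnit)
  dd k y := rfl
  π := LinearMap.id
  surj := fun x => ⟨x, rfl⟩
  πd y := Submodule.zero_mem _
  htpy b hb := hb.elim

/-- cone modules -/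
def coneY (Y : ℕ → ModuleCat.{u} R) (k : ℕ) : ModuleCat.{u} R := match k with
    | 0 => Y 0
    | k + 1 => ModuleCat.of R (Y (k + 1) × Y k)

/-- cone differential -/
def coneD (Y : ℕ → ModuleCat.{u} R) (d : ∀ k, Y (k+1) →ₗ[R] Y k) (a : R) (k : ℕ) :
    coneY Y (k+1) →ₗ[R] coneY Y k := match k with
    | 0 => ((d 0).coprod (a • LinearMap.id) : (Y 1 × Y 0) →ₗ[R] Y 0)
    | k + 1 => (((d (k+1)).coprod (a • LinearMap.id)).prod (-((d k) ∘ₗ LinearMap.snd R _ _)) :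
        (Y (k+2) × Y (k+1)) →ₗ[R] (Y (k+1) × Y k))

/-- homotopy for a -/
def coneHa (Y : ℕ → ModuleCat.{u} R) (k : ℕ) :
    coneY Y k →ₗ[R] coneY Y (k+1) := match k with
    | 0 => (LinearMap.inr R _ _ : Y 0 →ₗ[R] (Y 1 × Y 0))
    | k + 1 => (LinearMap.inr R _ _ ∘ₗ LinearMap.fst R _ _ :
        (Y (k+1) × Y k) →ₗ[R] (Y (k+2) × Y (k+1)))

/-- homotopy for b -/
def coneHb (Y : ℕ → ModuleCat.{u} R) (h : ∀ k, Y k →ₗ[R] Y (k+1)) (k : ℕ) :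
    coneY Y k →ₗ[R] coneY Y (k+1) := match k with
    | 0 => (LinearMap.inl R _ _ ∘ₗ h 0 : Y 0 →ₗ[R] (Y 1 × Y 0))
    | k + 1 => (LinearMap.prodMap (h (k+1)) (-(h k)) :
        (Y (k+1) × Y k) →ₗ[R] (Y (k+2) × Y (k+1)))

/-- cone -/
def Kos.cone {I : Ideal R} {T : Type u} [AddCommGroup T] [Module R T] {s : Set R} (C : Kos I T s)
    (a : R) : Kos I T (insert a s) where
  Y := coneY C.Y
  d := coneD C.Y C.d a
  ve k := match k with
    | 0 => C.ve 0
    | k + 1 => (C.ve (k+1)).prod (C.ve k)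
  m := C.m + 1
  sub k hk := match k, hk with
    | k + 1, hk => by
      have h1 := C.sub (k+1) (by lia)
      have h2 := C.sub k (by lia)
      exact inferInstanceAs (Subsingleton (C.Y (k + 1) × C.Y k))
  dd k y := by
    match k, y with
    | 0, y =>
      obtain ⟨y, z⟩ := (y : C.Y 2 × C.Y 1)
      change C.d 0 (C.d 1 y + a • z) + a • (-(C.d 0 z)) = 0
      rw [map_add, C.dd, map_smul]; simp
    | k + 1, y =>
      obtain ⟨y, z⟩ := (y : C.Y (k + 3) × C.Y (k + 2))
      refine Prod.ext ?_ ?_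
      · change C.d (k+1) (C.d (k+2) y + a • z) + a • (-(C.d (k+1) z)) = 0
        rw [map_add, C.dd, map_smul]; simp
      · change -(C.d k (-(C.d (k+1) z))) = 0
        rw [map_neg, C.dd]; simp
  π := C.π
  surj := C.surj
  πd y := by
    obtain ⟨y, z⟩ := (y : C.Y 1 × C.Y 0)
    change C.π (C.d 0 y + a • z) ∈ _
    rw [map_add, map_smul]
    refine Submodule.add_mem _ ?_ ?_
    · exact Submodule.smul_mono_left (Ideal.span_mono (Set.subset_insert _ _)) (C.πd y)
    · exact Submodule.smul_mem_smul (Ideal.subset_span (Set.mem_insert _ _)) trivial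
  htpy b hb := by
    rcases hb with rfl | hb
    · refine ⟨coneHa C.Y, ?_, ?_⟩
      · intro y
        change C.d 0 0 + b • _ = b • y
        rw [map_zero, zero_add]; rfl
      · intro k y
        match k, y with
        | 0, y =>
          obtain ⟨y, z⟩ := (y : C.Y 1 × C.Y 0)
          refine Prod.ext ?_ ?_
          · change C.d 1 0 + b • y + 0 = b • y
            simp
          · change -(C.d 0 y) + (C.d 0 y + b • z) = b • z
            simp
        | k + 1, y =>
          obtain ⟨y, z⟩ := (y : C.Y (k+2) × C.Y (k+1))
          refine Prod.ext ?_ ?_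
          · change C.d (k+2) 0 + b • y + 0 = b • y
            simp
          · change -(C.d (k+1) y) + (C.d (k+1) y + b • z) = b • z
            simp
    · obtain ⟨h, h0, h1⟩ := C.htpy b hb
      refine ⟨coneHb C.Y h, ?_, ?_⟩
      · have h2 : ∀ y : C.Y 0, C.d 0 (h 0 y) + a • (0 : C.Y 0) = b • y := by
          intro y
          rw [h0, smul_zero, add_zero]
        exact h2
      · intro k y
        match k, y with
        | 0, y =>
          obtain ⟨y, z⟩ := (y : C.Y 1 × C.Y 0)
          refine Prod.ext ?_ ?_
          · change C.d 1 (h 1 y) + a • (-(h 0 z)) + h 0 (C.d 0 y + a • z) = b • y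
            rw [map_add, map_smul, ← h1]; simp; abel
          · change -(C.d 0 (-(h 0 z))) + 0 = b • z
            rw [map_neg, h0]; simp
        | k + 1, y =>
          obtain ⟨y, z⟩ := (y : C.Y (k+2) × C.Y (k+1))
          refine Prod.ext ?_ ?_
          · change C.d (k+2) (h (k+2) y) + a • (-(h (k+1) z)) + h (k+1) (C.d (k+1) y + a • z) = b • y
            rw [map_add, map_smul, ← h1]; simp; abel
          · change -(C.d (k+1) (-(h (k+1) z))) + -(h k (-(C.d k z))) = b • z
            rw [map_neg, map_neg, ← h1]; simp

lemma Kos.ex (I : Ideal R) (T : Type u) [AddCommGroup T] [Module R T] (hT : VE I T) (s : Finset R) :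
    Nonempty (Kos I T (s : Set R)) := by
  classical
  induction s using Finset.induction_on with
  | empty => rw [Finset.coe_empty]; exact ⟨Kos.base I T hT⟩
  | insert a s _ ih => rw [Finset.coe_insert]; exact ⟨ih.some.cone a⟩

lemma mem_of_VE_quot {I : Ideal R} (B : Submodule R K) (h : VE I (K ⧸ B)) (s : Set R)
    (hs : Ideal.span s = I) (z : K) (hz : ∀ b ∈ s, b • z ∈ B) : z ∈ B := by
  have h1 := TF.iff_sub.2 (h 0)
  rw [← Submodule.Quotient.mk_eq_zero]
  apply h1
  have h2 : I ≤ LinearMap.ker (LinearMap.toSpanSingleton R (K ⧸ B) (Submodule.Quotient.mk z)) := by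
    rw [← hs, Ideal.span_le]
    intro b hb
    exact (Submodule.Quotient.mk_eq_zero B).2 (hz b hb)
  intro b hb
  exact h2 hb

lemma VE.smul_top {I : Ideal R} {T : Type u} [AddCommGroup T] [Module R T] (hT : VE I T) (t : T) :
    t ∈ (I • ⊤ : Submodule R T) := by
  obtain ⟨s, hs⟩ := (IsNoetherian.noetherian I : I.FG)
  have hs : Ideal.span (s : Set R) = I := hs
  obtain ⟨C⟩ := Kos.ex I T hT s
  have hB : ∀ j k, C.m ≤ k + j → VE I (LinearMap.range (C.d k)) := by
    intro j
    induction j with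
    | zero =>
      intro k hk
      have := C.sub k hk
      exact VE.of_sub I
    | succ j ih =>
      intro k hk
      have h1 := ih (k+1) (by lia)
      have h2 : VE I (C.Y (k+1) ⧸ LinearMap.range (C.d (k+1))) :=
        VE.right _ _ (Submodule.injective_subtype _) (exact_mkQ _) (Submodule.mkQ_surjective _)
          h1 (C.ve (k+1))
      refine VE.right (LinearMap.range (C.d (k+1))).subtype (C.d k).rangeRestrict
        (Submodule.injective_subtype _) ?_ (LinearMap.surjective_rangeRestrict _) h1 (C.ve (k+1))
      rw [LinearMap.exact_iff, LinearMap.ker_rangeRestrict, Submodule.range_subtype]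
      apply le_antisymm
      · intro z hz
        refine mem_of_VE_quot _ h2 s hs z ?_
        intro b hb
        obtain ⟨h, _, hh⟩ := C.htpy b hb
        rw [← hh k z, LinearMap.mem_ker.1 hz, map_zero, add_zero]
        exact LinearMap.mem_range_self _ _
      · rintro _ ⟨y, rfl⟩
        exact C.dd k y
  have h1 := hB C.m 0 (by lia)
  have h2 : VE I (C.Y 0 ⧸ LinearMap.range (C.d 0)) :=
    VE.right _ _ (Submodule.injective_subtype _) (exact_mkQ _) (Submodule.mkQ_surjective _)
      h1 (C.ve 0)
  obtain ⟨y, rfl⟩ := C.surj t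
  have : y ∈ LinearMap.range (C.d 0) := by
    refine mem_of_VE_quot _ h2 s hs y ?_
    intro b hb
    obtain ⟨h, hh, _⟩ := C.htpy b hb
    rw [← hh y]
    exact LinearMap.mem_range_self _ _
  obtain ⟨z, rfl⟩ := this
  have := C.πd z
  rwa [hs] at this

end Kosz

end CofPf

namespace CofPf

section CaseB

set_option linter.unusedSectionVars false

variable {R : Type u} [CommRing R] [IsNoetherianRing R]

variable {K L N : Type u} 
  [AddCommGroup K] [Module R K] [AddCommGroup L] [Module R L] [AddCommGroup N] [Module R N]

/-- restriction to a power -/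
noncomputable def iot (J : Ideal R) (K : Type u) [AddCommGroup K] [Module R K] :
    K →ₗ[R] HomM R J K :=
  (LinearMap.lsmul R K ∘ₗ J.subtype).flip

lemma iot_apply (J : Ideal R) (x : K) (b : J) : iot J K x b = (b : R) • x := rfl

lemma iot_ker (J : Ideal R) (h : FE (R := R) (R ⧸ J) K 0) :
    Module.Finite R (LinearMap.ker (iot J K)) := by
  have h1 := FE0_iff.1 h
  have : LinearMap.ker (iot J K) = an J K := by
    ext x
    constructor
    · intro hx a ha
      exact LinearMap.congr_fun hx ⟨a, ha⟩
    · intro hx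
      ext b
      exact hx b.1 b.2
  rw [this]
  exact h1

lemma iot_coker (J : Ideal R) (h : FE (R := R) (R ⧸ J) K 1) :
    Module.Finite R (HomM R J K ⧸ LinearMap.range (iot J K)) := by
  have h : Module.Finite R (EE R (R ⧸ J) K 1) := h
  let ψ : HomM R J K →ₗ[R] EE R (R ⧸ J) K 1 :=
    cdelta K J.subtype J.mkQ (Submodule.injective_subtype _) (exact_mkQ _)
      (Submodule.mkQ_surjective _) 0 ∘ₗ (e0 (R := R) J K).symm.toLinearMap
  have hle : LinearMap.ker ψ ≤ LinearMap.range (iot J K) := by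
    intro φ hφ
    obtain ⟨e, he⟩ := (cles1 K J.subtype J.mkQ (Submodule.injective_subtype _) (exact_mkQ _)
      (Submodule.mkQ_surjective _) 0 _).1 hφ
    refine ⟨e0 (R := R) R K e 1, ?_⟩
    have h2 : e0 (R := R) J K (epre K J.subtype 0 e) = φ := by
      rw [he]
      exact LinearEquiv.apply_symm_apply _ _
    rw [e0_epre] at h2
    rw [← h2]
    ext b
    rw [iot_apply, ← map_smul, smul_eq_mul, mul_one]
    rfl
  have h3 : Module.Finite R (HomM R J K ⧸ LinearMap.ker ψ) :=
    Module.Finite.equiv ψ.quotKerEquivRange.symm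
  exact Module.Finite.of_surjective (Submodule.factor hle) (Submodule.factor_surjective hle)

lemma ex_T {I p : Ideal R} [p.IsPrime] (hIp : ¬ I ≤ p) 
    (hH : ∀ i, Subsingleton (HH I (i+2) (R ⧸ p))) :
    ∃ (E : Type u) (_ : AddCommGroup E) (_ : Module R E) (f : (R ⧸ p) →ₗ[R] E) (T : Submodule R E),
      Function.Injective f ∧ (∀ t ∈ T, ∃ n : ℕ, ∀ a ∈ I ^ n, a • t ∈ LinearMap.range f) ∧
      f 1 ∈ I • T := by
  have hTF : TF I (R ⧸ p) := by
    intro x hx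
    obtain ⟨a, ha, hap⟩ := Set.not_subset.1 hIp
    obtain ⟨x, rfl⟩ := Ideal.Quotient.mk_surjective x
    have h1 : Ideal.Quotient.mk p (a * x) = 0 := hx a ha
    rw [Ideal.Quotient.eq_zero_iff_mem] at h1 ⊢
    exact (Ideal.IsPrime.mem_or_mem ‹_› h1).resolve_left hap
  obtain ⟨E, _, _, f, hE, hf⟩ := exists_sigma _ hTF
  let Q := E ⧸ LinearMap.range f
  let g : E →ₗ[R] Q := (LinearMap.range f).mkQ
  have hg : Function.Surjective g := Submodule.mkQ_surjective _
  have hfg : Function.Exact f g := LinearMap.exact_map_mkQ_range f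
  have hQ : ∀ i, Subsingleton (HH I (i+1) Q) := by
    intro i
    obtain ⟨e⟩ := K1a I f g hf hfg hg hE (i+1)
    have := hH i
    exact e.injective.subsingleton
  have hQG : ∀ j, Subsingleton (HH I j (Q ⧸ Gam I Q)) := by
    intro j
    cases j with
    | zero =>
      obtain ⟨e⟩ := K0 (K := Q ⧸ Gam I Q) I
      have h1 := TF.gam (TF.quot_Gam (K := Q) I)
      have h2 : Subsingleton (Gam I (Q ⧸ Gam I Q)) := by
        rw [h1]; infer_instance
      exact e.injective.subsingleton
    | succ j =>
      obtain ⟨e⟩ := K1b I (Gam I Q).subtype (Gam I Q).mkQ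
        (Submodule.subtype_injective _) (exact_mkQ _) (Submodule.mkQ_surjective _)
        (Tors.Gam I) j
      have := hQ j
      exact e.symm.injective.subsingleton
  have hVQ : VE I (Q ⧸ Gam I Q) := fun i => VE_of_HH I i _ hQG
  let T : Submodule R E := (Gam I Q).comap g
  have hVT : VE I T := by
    refine VE.left T.subtype ((Gam I Q).mkQ ∘ₗ g) (Submodule.injective_subtype _) ?_
      ((Submodule.mkQ_surjective _).comp hg) hE hVQ
    rw [LinearMap.exact_iff, LinearMap.ker_comp, Submodule.ker_mkQ, Submodule.range_subtype]
  refine ⟨E, _, _, f, T, hf, ?_, ?_⟩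
  · rintro t ⟨n, hn⟩
    refine ⟨n, fun a ha => ?_⟩
    have := hn a ha
    rw [← map_smul] at this
    exact (Submodule.Quotient.mk_eq_zero _).1 this
  · have h1 : f 1 ∈ T := by
      change g (f 1) ∈ Gam I Q
      rw [hfg.apply_apply_eq_zero]
      exact Submodule.zero_mem _
    have h2 := VE.smul_top hVT ⟨f 1, h1⟩
    have h3 := Submodule.mem_map_of_mem (f := T.subtype) h2
    rwa [Submodule.map_smul'', Submodule.map_top, Submodule.range_subtype] at h3

/-- action of R/p -/
noncomputable def sg (p : Ideal R) (hp : ∀ r ∈ p, ∀ k : K, r • k = 0) : (R ⧸ p) →ₗ[R] (HomM R K K) :=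
  p.liftQ (LinearMap.lsmul R K) (fun r hr => by ext k; exact hp r hr k)

lemma ex_m {p J : Ideal R} (hp : ∀ r ∈ p, ∀ k : K, r • k = 0) (f : (R ⧸ p) →ₗ[R] L)
    (hf : Function.Injective f) (t : L) (ht : ∀ a ∈ J, a • t ∈ LinearMap.range f) :
    ∃ m : K →ₗ[R] HomM R J K, ∀ (b : J), ∃ c : R ⧸ p, f c = (b : R) • t ∧ ∀ x, m x b = sg p hp c x := by
  let φ0 : J →ₗ[R] LinearMap.range f :=
    LinearMap.codRestrict _ (LinearMap.toSpanSingleton R L t ∘ₗ J.subtype) (fun b => ht b.1 b.2)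
  let φ : J →ₗ[R] R ⧸ p := (LinearEquiv.ofInjective f hf).symm.toLinearMap ∘ₗ φ0
  refine ⟨(sg p hp ∘ₗ φ).flip, fun b => ⟨φ b, ?_, fun x => rfl⟩⟩
  have h1 : LinearEquiv.ofInjective f hf (φ b) = φ0 b := LinearEquiv.apply_symm_apply _ _
  exact congrArg Subtype.val h1

lemma PP.caseB' {I p : Ideal R} (hpp : p.IsPrime) (hIp : ¬ I ≤ p) 
    (hH : ∀ i, Subsingleton (HH I (i+2) (R ⧸ p))) : PP I p := by
  classical
  intro K _ _ hT hp h0 h1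
  obtain ⟨E, _, _, f, T, hf, hTn, hmem⟩ := ex_T hIp hH
  have hspan : T = Submodule.span R (Set.range (Subtype.val : T → E)) := by simp
  rw [hspan, Submodule.mem_ideal_smul_span_iff_exists_sum] at hmem
  obtain ⟨a, ha, hsum⟩ := hmem
  choose n hn using fun t : T => hTn t.1 t.2
  let M := ∑ t ∈ a.support, n t
  have hM : ∀ t ∈ a.support, ∀ b ∈ I ^ M, b • (t : E) ∈ LinearMap.range f := by
    intro t ht b hb
    refine hn t b (Ideal.pow_le_pow_right ?_ hb)
    exact Finset.single_le_sum (f := n) (fun _ _ => Nat.zero_le _) ht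
  have hm : ∀ t : T, ∃ m : K →ₗ[R] HomM R (I ^ M : Ideal R) K, t ∈ a.support →
      ∀ (b : (I ^ M : Ideal R)), ∃ c : R ⧸ p, f c = (b : R) • (t : E) ∧ ∀ x, m x b = sg p hp c x := by
    intro t
    by_cases ht : t ∈ a.support
    · obtain ⟨m, hm⟩ := ex_m hp f hf t.1 (hM t ht)
      exact ⟨m, fun _ => hm⟩
    · exact ⟨0, fun h => absurd h ht⟩
  choose m hm using hm
  have hιm : iot (I ^ M) K = ∑ t ∈ a.support, a t • m t := by
    apply LinearMap.ext; intro x; apply LinearMap.ext; intro b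
    have hc : ∀ t : T, ∃ c : R ⧸ p, t ∈ a.support → f c = (b : R) • (t : E) ∧
        ∀ x, m t x b = sg p hp c x := by
      intro t
      by_cases ht : t ∈ a.support
      · obtain ⟨c, hc⟩ := hm t ht b
        exact ⟨c, fun _ => hc⟩
      · exact ⟨0, fun h => absurd h ht⟩
    choose c hc using hc
    have hcs : ∑ t ∈ a.support, a t • c t = (b : R) • (1 : R ⧸ p) := by
      apply hf
      rw [map_sum, map_smul, ← hsum, Finsupp.sum, Finset.smul_sum]
      refine Finset.sum_congr rfl fun t ht => ?_
      rw [map_smul, (hc t ht).1, smul_comm]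
    have h2 : sg p hp ((b : R) • (1 : R ⧸ p)) x = (b : R) • x := by
      rw [map_smul, LinearMap.smul_apply]
      have : sg p hp (1 : R ⧸ p) x = (1 : R) • x := rfl
      rw [this, one_smul]
    rw [iot_apply, ← h2, ← hcs, map_sum, LinearMap.sum_apply, LinearMap.sum_apply,
      LinearMap.sum_apply]
    refine Finset.sum_congr rfl fun t ht => ?_
    rw [map_smul, LinearMap.smul_apply, LinearMap.smul_apply, LinearMap.smul_apply, (hc t ht).2]
  have hF : ∀ i ≤ 1, FE (R := R) (R ⧸ I) K i := by
    intro i hi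
    interval_cases i
    · exact h0
    · exact h1
  have hk := iot_ker (I ^ M) (devissage_fin I 1 hF 0 (by lia) (Tors.quot_pow I M))
  have hck := iot_coker (I ^ M) (devissage_fin I 1 hF 1 (by lia) (Tors.quot_pow I M))
  refine Cof.of_epost_zero I (iot (I ^ M) K) Cof.of_fin Cof.of_fin ?_
  intro i
  rw [hιm, epost_sum]
  refine Finset.sum_eq_zero fun t _ => ?_
  rw [epost_smul]
  ext e
  rw [LinearMap.smul_apply, LinearMap.zero_apply]
  refine smul_EE (a t) ?_ i _
  intro x
  obtain ⟨x, rfl⟩ := Submodule.Quotient.mk_surjective _ x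
  rw [← Submodule.Quotient.mk_smul]
  exact (Submodule.Quotient.mk_eq_zero I).2 (I.mul_mem_right x (ha t))

lemma PP.caseB {I p : Ideal R} (hpp : p.IsPrime)
    (hcd : cohomologicalDim I (ModuleCat.of R (R ⧸ p)) = 1) : PP I p := by
  by_cases hIp : I ≤ p
  · exact PP.caseA1 I hIp
  refine PP.caseB' hpp hIp fun i => ?_
  have e := lcEquiv I (i+2) (ModuleCat.of R (R ⧸ p))
  by_contra hcon
  have h1 : Nontrivial ((localCohomology I (i+2)).obj (ModuleCat.of R (R ⧸ p))) := by
    by_contra h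
    rw [not_nontrivial_iff_subsingleton] at h
    exact hcon e.injective.subsingleton
  have h2 : (((i+2 : ℕ) : ℕ∞) : WithBot ℕ∞) ≤ 1 := by
    rw [← hcd]
    exact le_sSup ⟨i+2, h1, rfl⟩
  have h3 : i + 2 ≤ 1 := by exact_mod_cast h2
  lia

end CaseB

end CofPf

theorem memCofiniteClass_of_mAss_eq {R : Type u} [CommRing R] [IsNoetherianRing R] (I : Ideal R)
    (h : minimalAssociatedPrimes R = frakA I ∪ frakB I ∪ frakD I) :
    ∀ M : ModuleCat.{u} R, Module.Finite R M →
      ∀ i : ℕ, IsCofinite I ((localCohomology I i).obj M) := by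
  intro M hM i
  refine CofPf.isCofinite_of_PP I (CofPf.PP.of_min I ?_) M hM i
  intro p hp
  have hpp : p.IsPrime := hp.1.isPrime
  rw [h] at hp
  rcases hp with (hp | hp) | hp
  · rcases hp.2 with h1 | h1
    · exact CofPf.PP.caseA2 I h1
    · exact CofPf.PP.caseA1 I h1
  · exact CofPf.PP.caseB hpp hp.2
  · exact CofPf.PP.caseD hp.2.2
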